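/- arXiv:2104.11019 — 2 statements merged into one kernel-verified Lean document; each statement's English description precedes it below -/
import Mathlib

section
/- Let D be a connected arc-locally out-semicomplete digraph. Then at least one of the following holds: (i) D is a diperfect digraph; (ii) V(D) can be partitioned into (V1,V2,V3) such that the subdigraph induced by V1 is semicomplete, every vertex of V2 dominates every vertex of V1 and there is no arc from V1 to V2, there is no arc from V1 to V3, the subdigraph induced by V2 is an odd extended cycle of length at least five, there is no arc from V2 to V3, the subdigraph induced by V3 is bipartite, and V1 or V3 (or both) may be empty; (iii) D has a clique cut. -/
variable {V : Type*}

/-- `u` and `v` are adjacent in the digraph with arc relation `A`. -/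
def DAdj (A : V → V → Prop) (u v : V) : Prop := A u v ∨ A v u

/-- `A` is arc-locally in-semicomplete: for any four distinct vertices
`v1,v2,v3,v4` with `v1→v2`, `v2→v3`, `v4→v3`, the vertices `v1,v4` are adjacent. -/
def ArcLocallyIn (A : V → V → Prop) : Prop :=
  ∀ v1 v2 v3 v4 : V, v1 ≠ v2 → v1 ≠ v3 → v1 ≠ v4 → v2 ≠ v3 → v2 ≠ v4 → v3 ≠ v4 →
    A v1 v2 → A v2 v3 → A v4 v3 → DAdj A v1 v4

/-- `A` is arc-locally out-semicomplete: for any four distinct vertices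
`v1,v2,v3,v4` with `v2→v1`, `v2→v3`, `v3→v4`, the vertices `v1,v4` are adjacent. -/
def ArcLocallyOut (A : V → V → Prop) : Prop :=
  ∀ v1 v2 v3 v4 : V, v1 ≠ v2 → v1 ≠ v3 → v1 ≠ v4 → v2 ≠ v3 → v2 ≠ v4 → v3 ≠ v4 →
    A v2 v1 → A v2 v3 → A v3 v4 → DAdj A v1 v4

/-- The underlying simple graph of the digraph `A`. -/
def Underlying (A : V → V → Prop) : SimpleGraph V := SimpleGraph.fromRel A

/-- A simple graph is perfect if every induced subgraph has chromatic number
equal to its clique number. -/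
def GraphPerfect (G : SimpleGraph V) : Prop :=
  ∀ S : Set V, (G.induce S).chromaticNumber = ((G.induce S).cliqueNum : ℕ∞)

/-- A digraph is diperfect if its underlying graph is perfect. -/
def Diperfect (A : V → V → Prop) : Prop := GraphPerfect (Underlying A)

/-- The pairs of consecutive arcs `x ∈ S, y ∈ S, x→y` restricted to `S`. -/
def ArcOn (A : V → V → Prop) (S : Set V) (x y : V) : Prop := x ∈ S ∧ y ∈ S ∧ A x y

/-- The induced subdigraph on `S` is strong. -/
def StrongOn (A : V → V → Prop) (S : Set V) : Prop :=
  ∀ u ∈ S, ∀ v ∈ S, Relation.ReflTransGen (ArcOn A S) u v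

/-- `S` is (the vertex set of) a strong component: a maximal set inducing a
strong subdigraph. -/
def IsStrongComponent (A : V → V → Prop) (S : Set V) : Prop :=
  S.Nonempty ∧ StrongOn A S ∧ ∀ T : Set V, S ⊆ T → StrongOn A T → T ⊆ S

/-- The strong component `S` is initial: no outside vertex dominates a vertex of `S`. -/
def IsInitial (A : V → V → Prop) (S : Set V) : Prop :=
  ∀ v, v ∉ S → ∀ u ∈ S, ¬ A v u

/-- The digraph is strong. -/
def IsStrong (A : V → V → Prop) : Prop := ∀ u v : V, Relation.ReflTransGen A u v

/-- There is a directed path from `u` to `v`. -/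
def Reach (A : V → V → Prop) (u v : V) : Prop := Relation.ReflTransGen A u v

/-- The induced subdigraph on `S` is semicomplete. -/
def SemicompleteOn (A : V → V → Prop) (S : Set V) : Prop :=
  ∀ u ∈ S, ∀ v ∈ S, u ≠ v → DAdj A u v

/-- The induced subdigraph on `S` is bipartite (its underlying graph is 2-colorable). -/
def BipartiteOn (A : V → V → Prop) (S : Set V) : Prop :=
  ∃ T : Set V, ∀ u ∈ S, ∀ v ∈ S, DAdj A u v →
    ((u ∈ T ∧ v ∉ T) ∨ (u ∉ T ∧ v ∈ T))

/-- The induced subdigraph on `S` is connected (in the underlying graph). -/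
def ConnOn (A : V → V → Prop) (S : Set V) : Prop :=
  ∀ u ∈ S, ∀ v ∈ S,
    Relation.ReflTransGen (fun x y => x ∈ S ∧ y ∈ S ∧ DAdj A x y) u v

/-- The digraph is connected. -/
def IsConnected' (A : V → V → Prop) : Prop := ConnOn A Set.univ

/-- `D` has a clique cut: a set `B` inducing a semicomplete subdigraph whose
removal disconnects the digraph. -/
def HasCliqueCut (A : V → V → Prop) : Prop :=
  ∃ B : Set V, SemicompleteOn A B ∧ ¬ ConnOn A Bᶜ

/-- The induced subdigraph on `S` is an extended cycle of length `k`: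
`S` is partitioned into `k` nonempty (necessarily stable) sets `X 0, …, X (k-1)`
and the arcs between vertices of `S` are exactly those from `X i` to `X (i+1)`
(indices modulo `k`). -/
def IsExtendedCycleOn (A : V → V → Prop) (S : Set V) (k : ℕ) : Prop :=
  2 ≤ k ∧ ∃ X : ZMod k → Set V,
    (∀ i, (X i).Nonempty) ∧
    (∀ i j, i ≠ j → Disjoint (X i) (X j)) ∧
    (⋃ i, X i) = S ∧
    (∀ u ∈ S, ∀ v ∈ S, (A u v ↔ ∃ i, u ∈ X i ∧ v ∈ X (i + 1)))

/-- The induced subdigraph on `S` is an odd extended cycle of length at least five. -/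
def IsOddExtCycle5On (A : V → V → Prop) (S : Set V) : Prop :=
  ∃ k : ℕ, Odd k ∧ 5 ≤ k ∧ IsExtendedCycleOn A S k

namespace ALO

section Basic
variable {A : V → V → Prop}

/-- The key reformulation of the arc-local condition. -/
theorem two (hirr : Irreflexive A) (hD : ArcLocallyOut A) {u w y x : V}
    (h1 : A u w) (h2 : A w y) (hne : y ≠ u) (h3 : A u x) : x = y ∨ A x y ∨ A y x := by
  by_cases hxy : x = y
  · exact Or.inl hxy
  by_cases hxw : x = w
  · subst hxw; exact Or.inr (Or.inl h2)
  have ne : ∀ {p q : V}, A p q → p ≠ q := by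
    intro p q h e; subst e; exact hirr p h
  exact Or.inr (hD x u w y (ne h3).symm hxw hxy (ne h1) hne.symm (ne h2) h3 h1 h2)

theorem ne_of_arc (hirr : Irreflexive A) {p q : V} (h : A p q) : p ≠ q := by
  intro e; subst e; exact hirr p h

end Basic

section Hole
variable {A : V → V → Prop} {k : ℕ}

/-- An induced directed cycle indexed by `ZMod k`. -/
def Hole (A : V → V → Prop) (s : ZMod k → V) : Prop := ∀ i j, A (s i) (s j) ↔ j = i + 1

/-- `v` has the same arcs to and from the hole as `s j`. -/
def Twin (A : V → V → Prop) (s : ZMod k → V) (j : ZMod k) (v : V) : Prop :=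
  (∀ l, A (s l) v ↔ l + 1 = j) ∧ (∀ l, A v (s l) ↔ l = j + 1)

theorem twin_self {s : ZMod k → V} (hs : Hole A s) (j : ZMod k) : Twin A s j (s j) :=
  ⟨fun l => by rw [hs l j]; exact eq_comm, fun l => hs j l⟩

theorem small_ne (hk : 5 ≤ k) : (1 : ZMod k) ≠ 0 ∧ (2 : ZMod k) ≠ 0 ∧ (3 : ZMod k) ≠ 0 ∧
    (4 : ZMod k) ≠ 0 := by
  have key : ∀ n : ℕ, 0 < n → n < 5 → ((n : ℕ) : ZMod k) ≠ 0 := by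
    intro n h0 h5 h
    rw [ZMod.natCast_eq_zero_iff] at h
    have := Nat.le_of_dvd h0 h
    omega
  refine ⟨?_, ?_, ?_, ?_⟩
  · exact_mod_cast key 1 (by norm_num) (by norm_num)
  · exact_mod_cast key 2 (by norm_num) (by norm_num)
  · exact_mod_cast key 3 (by norm_num) (by norm_num)
  · exact_mod_cast key 4 (by norm_num) (by norm_num)

theorem step_two (hk : Odd k) (C : ZMod k → Prop) (j : ZMod k) (h0 : C j)
    (h : ∀ i, C i → C (i + 2)) (i : ZMod k) : C i := by
  obtain ⟨m, hm⟩ := hk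
  have : NeZero k := ⟨by omega⟩
  have h1 : ∀ n : ℕ, C (j + 2 * (n : ZMod k)) := by
    intro n
    induction n with
    | zero => simpa using h0
    | succ n ih =>
      have := h _ ih
      have e : j + 2 * (n : ZMod k) + 2 = j + 2 * ((n + 1 : ℕ) : ZMod k) := by push_cast; ring
      rwa [e] at this
  have h2 := h1 ((m + 1) * (i - j).val)
  have e0 : ((2 * m + 1 : ℕ) : ZMod k) = 0 := by rw [← hm]; simp
  have e : j + 2 * (((m + 1) * (i - j).val : ℕ) : ZMod k) = i := by
    push_cast at e0 ⊢
    rw [ZMod.natCast_zmod_val]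
    linear_combination (i - j) * e0
  rwa [e] at h2

theorem step_two' (hk : Odd k) (C : ZMod k → Prop) (j : ZMod k) (h0 : C j)
    (h : ∀ i, C (i + 2) → C i) (i : ZMod k) : C i := by
  have := step_two hk (fun i => C (-i)) (-j) (by simpa using h0) (fun i hi => by
    apply h; have e : -(i + 2) + 2 = -i := by ring
    rw [e]; exact hi) (-i)
  simpa using this


section

/-- At most one out-neighbour in a hole. -/
theorem out_unique (hirr : Irreflexive A) (hD : ArcLocallyOut A) (hk : 5 ≤ k)
    {s : ZMod k → V} (hs : Hole A s) {v : V} {i l : ZMod k}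
    (h1 : A v (s i)) (h2 : A v (s l)) : l = i := by
  obtain ⟨n1, n2, n3, n4⟩ := small_ne hk
  by_cases hv : ∃ m, v = s m
  · obtain ⟨m, rfl⟩ := hv
    rw [hs] at h1 h2; rw [h1, h2]
  push Not at hv
  have a1 := two hirr hD h1 ((hs i (i + 1)).2 rfl) (hv _).symm h2
  have a1 : l = i + 1 ∨ i + 1 = l + 1 ∨ l = i + 1 + 1 := by
    rcases a1 with h | h | h
    · left
      have : A (s i) (s l) := by rw [h, hs]
      rwa [hs] at this
    · rw [hs] at h; exact Or.inr (Or.inl h)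
    · rw [hs] at h; exact Or.inr (Or.inr h)
  rcases a1 with h | h | h
  · subst h
    rcases two hirr hD h2 ((hs _ (i + 1 + 1)).2 rfl) (hv _).symm h1 with h | h | h
    · have : A (s (i + 1)) (s i) := by rw [h, hs]
      rw [hs] at this
      exact absurd (by linear_combination -this) n2
    · rw [hs] at h
      exact absurd (by linear_combination h) n1
    · rw [hs] at h
      exact absurd (by linear_combination -h) n3
  · exact (add_right_cancel h).symm
  · subst h
    rcases two hirr hD h2 ((hs _ (i + 1 + 1 + 1)).2 rfl) (hv _).symm h1 with h | h | h
    · have : A (s (i + 1 + 1)) (s i) := by rw [h, hs]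
      rw [hs] at this
      exact absurd (by linear_combination -this) n3
    · rw [hs] at h
      exact absurd (by linear_combination h) n2
    · rw [hs] at h
      exact absurd (by linear_combination -h) n4

/-- Out-neighbours of a hole are twins or dominated by the whole hole. -/
theorem out_nbr (hirr : Irreflexive A) (hD : ArcLocallyOut A) (hk : 5 ≤ k) (hodd : Odd k)
    {s : ZMod k → V} (hs : Hole A s) {v : V} {i : ZMod k} (h : A (s i) v) :
    (∀ l, A (s l) v ∧ ¬ A v (s l)) ∨ ∃ j, Twin A s j v := by
  obtain ⟨n1, n2, n3, n4⟩ := small_ne hk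
  have step : ∀ l, A (s l) v → A (s (l + 2)) v ∨ A v (s (l + 2)) := by
    intro l hl
    have h2 : A (s (l + 1)) (s (l + 2)) := by rw [hs]; ring
    rcases two hirr hD ((hs l (l + 1)).2 rfl) h2 (by
      intro e
      have : A (s (l + 1)) (s l) := by rw [← e]; exact h2
      rw [hs] at this
      exact n2 (by linear_combination -this)) hl with h | h | h
    · subst h
      rw [hs] at hl
      exact absurd (by linear_combination hl) n1
    · exact Or.inr h
    · exact Or.inl h
  by_cases hy : ∃ j, A (s j) v ∧ A v (s (j + 2))
  · right
    obtain ⟨j, hj1, hj2⟩ := hy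
    have hbad : ¬ A (s (j - 2)) v := by
      intro hb
      rcases two hirr hD hb hj2 (by
        intro e
        have e1 : A (s (j + 1)) (s (j - 2)) := by rw [← e, hs]; ring
        rw [hs] at e1
        exact n4 (by linear_combination -e1)) ((hs (j - 2) (j - 2 + 1)).2 rfl) with h | h | h
      · have : A (s (j - 2)) (s (j + 2)) := by rw [← h, hs]
        rw [hs] at this
        exact n3 (by linear_combination this)
      · rw [hs] at h
        exact n2 (by linear_combination h)
      · rw [hs] at h
        exact n4 (by linear_combination -h)
    have all := step_two' hodd (fun i => i = j ∨ ¬ A (s i) v) j (Or.inl rfl) (by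
      intro i hi
      by_cases hij : i = j
      · exact Or.inl hij
      right
      intro hA
      rcases hi with hi | hi
      · apply hbad
        have : j - 2 = i := by rw [← hi]; ring
        rwa [this]
      · rcases step i hA with h | h
        · exact hi h
        · have := out_unique hirr hD hk hs h hj2
          exact hij (add_right_cancel this).symm)
    refine ⟨j + 1, fun l => ⟨fun hl => ?_, fun hl => ?_⟩, fun l => ⟨fun hl => ?_, fun hl => ?_⟩⟩
    · rcases all l with h | h
      · rw [h]
      · exact absurd hl h
    · rw [add_right_cancel hl]; exact hj1
    · rw [out_unique hirr hD hk hs hj2 hl]; ring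
    · have : l = j + 2 := by rw [hl]; ring
      rw [this]; exact hj2
  · left
    push Not at hy
    have all : ∀ l, A (s l) v := step_two hodd (fun l => A (s l) v) i h (fun l hl =>
      (step l hl).resolve_right (hy l hl))
    intro l
    refine ⟨all l, fun hl => hy (l - 2) (all _) ?_⟩
    have : l - 2 + 2 = l := by ring
    rwa [this]

/-- Arcs between twins. -/
theorem twin_arc (hirr : Irreflexive A) (hD : ArcLocallyOut A) (hk : 5 ≤ k)
    {s : ZMod k → V} (hs : Hole A s) {x y : V} {i j : ZMod k}
    (hx : Twin A s i x) (hy : Twin A s j y) : A x y ↔ j = i + 1 := by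
  obtain ⟨n1, n2, n3, n4⟩ := small_ne hk
  constructor
  · intro hA
    have hx1 : A x (s (i + 1)) := (hx.2 _).2 rfl
    rcases two hirr hD hx1 ((hs (i + 1) (i + 1 + 1)).2 rfl) (by
      intro e
      rw [← e, hs] at hx1
      exact n2 (by linear_combination -hx1)) hA with h | h | h
    · rw [h, hx.2] at hA
      exact absurd (by linear_combination hA) n1
    · rw [hy.2] at h
      linear_combination -h
    · rw [hy.1] at h
      have hy4 : A y (s (i + 4)) := by rw [hy.2]; linear_combination h
      rcases two hirr hD hA hy4 (by
        intro e
        rw [← e, hs] at hx1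
        exact n4 (by linear_combination -hx1)) hx1 with h | h | h
      · have : A (s i) (s (i + 4)) := by rw [← h, hs]
        rw [hs] at this
        exact absurd (by linear_combination this) n3
      · rw [hs] at h
        exact absurd (by linear_combination h) n2
      · rw [hs] at h
        exact absurd (by linear_combination -h) n4
  · intro e
    have h1 : A (s (i - 1)) (s i) := by rw [hs]; ring
    have h2 : A (s i) y := by rw [hy.1]; exact e.symm
    have h3 : A (s (i - 1)) x := by rw [hx.1]; ring
    have hy2 : A y (s (i + 2)) := by rw [hy.2, e]; ring
    have hx1 : A x (s (i + 1)) := (hx.2 _).2 rfl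
    rcases two hirr hD h1 h2 (by
      intro e1
      rw [e1, hs] at hy2
      exact n2 (by linear_combination hy2)) h3 with h | h | h
    · rw [← h, hx.2] at hy2
      exact absurd (by linear_combination hy2) n1
    · exact h
    · have h23 : A (s (i + 2)) (s (i + 3)) := by rw [hs]; ring
      rcases two hirr hD hy2 h23 (by
        intro e1
        rw [← e1, hs] at hy2
        exact n2 (by linear_combination -hy2)) h with h | h | h
      · rw [h, hs] at hx1
        exact absurd (by linear_combination -hx1) n3
      · rw [hx.2] at h
        exact absurd (by linear_combination h) n2
      · rw [hx.1] at h
        exact absurd (by linear_combination h) n4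

theorem hole_of_twins (hirr : Irreflexive A) (hD : ArcLocallyOut A) (hk : 5 ≤ k)
    {s s' : ZMod k → V} (hs : Hole A s) (h : ∀ l, Twin A s l (s' l)) :
    Hole A s' := fun i j => twin_arc hirr hD hk hs (h i) (h j)

theorem twin_update (hirr : Irreflexive A) (hD : ArcLocallyOut A) (hk : 5 ≤ k)
    {s : ZMod k → V} (hs : Hole A s) {i : ZMod k} {e : V} (he : Twin A s i e) :
    ∀ l, Twin A s l (Function.update s i e l) := by
  intro l
  by_cases h : l = i
  · subst h; simpa using he
  · rw [Function.update_of_ne h]; exact twin_self hs l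

theorem hole_update (hirr : Irreflexive A) (hD : ArcLocallyOut A) (hk : 5 ≤ k)
    {s : ZMod k → V} (hs : Hole A s) {i : ZMod k} {e : V} (he : Twin A s i e) :
    Hole A (Function.update s i e) :=
  hole_of_twins hirr hD hk hs (twin_update hirr hD hk hs he)

theorem out_of_twin (hirr : Irreflexive A) (hD : ArcLocallyOut A) (hk : 5 ≤ k) (hodd : Odd k)
    {s : ZMod k → V} (hs : Hole A s) {i : ZMod k} {e v : V} (he : Twin A s i e)
    (hA : A e v) : (∀ l, A (s l) v ∧ ¬ A v (s l)) ∨ ∃ j, Twin A s j v := by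
  obtain ⟨n1, n2, n3, n4⟩ := small_ne hk
  by_cases hex : ∃ l, A (s l) v
  · obtain ⟨l, hl⟩ := hex
    exact out_nbr hirr hD hk hodd hs hl
  push Not at hex
  have hs' := hole_update hirr hD hk hs he
  have hA' : A (Function.update s i e i) v := by simpa using hA
  have up : ∀ l, l ≠ i → Function.update s i e l = s l := fun l hl => Function.update_of_ne hl _ _
  have ne2 : i + 2 ≠ i := fun h => n2 (by linear_combination h)
  rcases out_nbr hirr hD hk hodd hs' hA' with h | ⟨j, h⟩
  · have := (h (i + 2)).1
    rw [up _ ne2] at this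
    exact absurd this (hex _)
  · have hj : i + 1 = j := (h.1 i).1 hA'
    have hv2 : A v (s (i + 2)) := by
      have := (h.2 (i + 2)).2 (by rw [← hj]; ring)
      rwa [up _ ne2] at this
    have h1 : A (s (i - 1)) e := by rw [he.1]; ring
    have h3 : A (s (i - 1)) (s i) := by rw [hs]; ring
    rcases two hirr hD h1 hA (by
      intro e1
      rw [e1, he.2] at hA
      exact n2 (by linear_combination -hA)) h3 with h | h | h
    · exact Or.inr ⟨i, h ▸ twin_self hs i⟩
    · exact absurd h (hex _)
    · exact absurd (out_unique hirr hD hk hs h hv2) ne2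

theorem twin_dom (hirr : Irreflexive A) (hD : ArcLocallyOut A) (hk : 5 ≤ k) (hodd : Odd k)
    {s : ZMod k → V} (hs : Hole A s) {i : ZMod k} {e v : V} (he : Twin A s i e)
    (hv : ∀ l, A (s l) v ∧ ¬ A v (s l)) : A e v ∧ ¬ A v e := by
  obtain ⟨n1, n2, n3, n4⟩ := small_ne hk
  have hs' := hole_update hirr hD hk hs he
  have up : ∀ l, l ≠ i → Function.update s i e l = s l := fun l hl => Function.update_of_ne hl _ _
  have h1 : A (Function.update s i e (i + 1)) v := by
    rw [up _ (fun h => n1 (by linear_combination h))]; exact (hv _).1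
  have h2 : A (Function.update s i e (i + 2)) v := by
    rw [up _ (fun h => n2 (by linear_combination h))]; exact (hv _).1
  rcases out_nbr hirr hD hk hodd hs' h1 with h | ⟨j, h⟩
  · simpa using h i
  · rw [h.1] at h1 h2
    exact absurd (by linear_combination h2 - h1) n1

theorem twin_out_unique (hirr : Irreflexive A) (hD : ArcLocallyOut A) (hk : 5 ≤ k)
    {s : ZMod k → V} (hs : Hole A s) {i j : ZMod k} {e e' r : V}
    (he : Twin A s i e) (he' : Twin A s j e') (h : A r e) (h' : A r e') : i = j := by
  by_contra hne
  have h1 : ∀ l, Twin A s l (Function.update (Function.update s i e) j e' l) := by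
    intro l
    by_cases hl : l = j
    · subst hl; simpa using he'
    · rw [Function.update_of_ne hl]; exact twin_update hirr hD hk hs he l
  have hs' := hole_of_twins hirr hD hk hs h1
  apply hne
  refine out_unique (v := r) hirr hD hk hs' (i := j) (l := i) ?_ ?_
  · simpa using h'
  · rw [Function.update_of_ne hne]; simpa using h

end

end Hole
end ALO
namespace ALO

section Struct
variable {A : V → V → Prop} {k : ℕ}

/-- `Lev A V3 M n v`: there is a directed walk of length `n` inside `V3` from `v` to `M`. -/
def Lev (A : V → V → Prop) (V3 M : Set V) : ℕ → V → Prop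
  | 0, v => v ∈ M
  | n + 1, v => v ∈ V3 ∧ ∃ w, w ∈ V3 ∧ A v w ∧ Lev A V3 M n w

theorem lev_uniq {V3 M : Set V} (hsink : ∀ v ∈ M, ∀ w ∈ V3, ¬ A v w) :
    ∀ n : ℕ, (∀ n' ≤ n, ∀ v o, Lev A V3 M n' v → o ∈ V3 → A v o → ∃ m, n' = m + 1 ∧ Lev A V3 M m o) →
    ∀ m v, Lev A V3 M n v → Lev A V3 M m v → n = m := by
  intro n
  induction n with
  | zero =>
    intro _ m v h h'
    cases m with
    | zero => rfl
    | succ m =>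
      obtain ⟨_, w, hw, hvw, _⟩ := h'
      exact absurd hvw (hsink v h w hw)
  | succ n ih =>
    intro hQ m v h h'
    cases m with
    | zero =>
      obtain ⟨_, w, hw, hvw, _⟩ := h
      exact absurd hvw (hsink v h' w hw)
    | succ m =>
      obtain ⟨_, w, hw, hvw, hl⟩ := h'
      obtain ⟨p, hp, hl'⟩ := hQ (n + 1) le_rfl v w h hw hvw
      obtain rfl : n = p := by omega
      rw [ih (fun n' hn' => hQ n' (by omega)) m w hl' hl]

theorem lev_step (hirr : Irreflexive A) (hD : ArcLocallyOut A) {V3 M : Set V} (hM : M ⊆ V3)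
    (hsink : ∀ v ∈ M, ∀ w ∈ V3, ¬ A v w)
    (hbase : ∀ v ∈ V3, ∀ m ∈ M, A v m → ∀ o ∈ V3, A v o → o ∈ M) :
    ∀ n : ℕ, ∀ v o, Lev A V3 M n v → o ∈ V3 → A v o → ∃ m, n = m + 1 ∧ Lev A V3 M m o := by
  intro n
  induction n using Nat.strong_induction_on with
  | _ n ih =>
    intro v o hl ho hvo
    match n, ih, hl with
    | 0, _, hl => exact absurd hvo (hsink v hl o ho)
    | 1, _, hl =>
      obtain ⟨hv, w, hw, hvw, hl⟩ := hl
      exact ⟨0, rfl, hbase v hv w hl hvw o ho hvo⟩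
    | j + 2, ih, hl =>
      have uniq : ∀ n ≤ j + 1, ∀ m v, Lev A V3 M n v → Lev A V3 M m v → n = m := fun n hn =>
        lev_uniq hsink n (fun n' hn' => ih n' (by omega))
      obtain ⟨hv, v1, hv1, hvv1, _, v0, hv0, hv10, hl0⟩ := hl
      have hl1 : Lev A V3 M (j + 1) v1 := ⟨hv1, v0, hv0, hv10, hl0⟩
      have hl2 : Lev A V3 M (j + 2) v := ⟨hv, v1, hv1, hvv1, hl1⟩
      have hne : v0 ≠ v := by
        rintro rfl
        have := uniq j (by omega) _ _ hl0 hl2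
        omega
      refine ⟨j + 1, rfl, ?_⟩
      rcases two hirr hD hvv1 hv10 hne hvo with h | h | h
      · subst h
        have : Lev A V3 M (j + 1) v := ⟨hv, o, ho, hvo, hl0⟩
        have := uniq (j + 1) (by omega) _ _ this hl2
        omega
      · exact ⟨ho, v0, hv0, h, hl0⟩
      · obtain ⟨m, hm, hlo⟩ := ih j (by omega) v0 o hl0 ho h
        have : Lev A V3 M (m + 1) v := ⟨hv, o, ho, hvo, hlo⟩
        have := uniq (m + 1) (by omega) _ _ this hl2
        omega

set_option maxHeartbeats 1600000 in
theorem struct (hirr : Irreflexive A) (hD : ArcLocallyOut A) (hk : 5 ≤ k) (hodd : Odd k)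
    {s : ZMod k → V} (hs : Hole A s) :
    (∃ V1 V2 V3 : Set V, Disjoint V1 V2 ∧ Disjoint V1 V3 ∧ Disjoint V2 V3 ∧
        V1 ∪ V2 ∪ V3 = Set.univ ∧
        SemicompleteOn A V1 ∧
        (∀ v ∈ V2, ∀ u ∈ V1, A v u) ∧
        (∀ u ∈ V1, ∀ v ∈ V2, ¬ A u v) ∧
        (∀ u ∈ V1, ∀ w ∈ V3, ¬ A u w) ∧
        IsOddExtCycle5On A V2 ∧
        (∀ v ∈ V2, ∀ w ∈ V3, ¬ A v w) ∧
        BipartiteOn A V3) ∨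
      HasCliqueCut A := by
  obtain ⟨n1, n2, n3, n4⟩ := small_ne hk
  set V1 : Set V := {v | ∀ l, A (s l) v ∧ ¬ A v (s l)} with hV1
  set E : Set V := ⋃ j, {v | Twin A s j v} with hE
  set V3 : Set V := (V1 ∪ E)ᶜ with hV3
  have memE : ∀ v, v ∈ E ↔ ∃ j, Twin A s j v := by intro v; simp [hE]
  have mem3 : ∀ v, v ∈ V3 ↔ v ∉ V1 ∧ v ∉ E := by intro v; simp [hV3]
  have sE : ∀ i, s i ∈ E := fun i => (memE _).2 ⟨i, twin_self hs i⟩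
  have d12 : ∀ v ∈ V1, v ∉ E := by
    intro v hv hvE
    obtain ⟨j, hj⟩ := (memE v).1 hvE
    exact (hv (j + 1)).2 ((hj.2 _).2 rfl)
  have dom21 : ∀ e ∈ E, ∀ v ∈ V1, A e v ∧ ¬ A v e := by
    intro e he v hv
    obtain ⟨j, hj⟩ := (memE e).1 he
    exact twin_dom hirr hD hk hodd hs hj hv
  have no23 : ∀ e ∈ E, ∀ v ∈ V3, ¬ A e v := by
    intro e he v hv hA
    obtain ⟨j, hj⟩ := (memE e).1 he
    rw [mem3] at hv
    rcases out_of_twin hirr hD hk hodd hs hj hA with h | h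
    · exact hv.1 h
    · exact hv.2 ((memE v).2 h)
  have clq : SemicompleteOn A V1 := by
    intro u hu v hv huv
    rcases two hirr hD ((hs 0 (0 + 1)).2 rfl) (hv (0 + 1)).1
      (ne_of_arc hirr (hv 0).1).symm (hu 0).1 with h | h
    · exact absurd h huv
    · exact h
  have no13 : ∀ u ∈ V1, ∀ w ∈ V3, ¬ A u w := by
    intro v hv w hw hA
    have hws : ∀ i, ¬ A (s i) w := fun i => no23 _ (sE i) w hw
    have hwE := (mem3 w).1 hw
    have hne : ∀ i, w ≠ s i := fun i e => hwE.2 (e ▸ sE i)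
    have all : ∀ i, A w (s (i + 1)) := by
      intro i
      rcases two hirr hD (hv i).1 hA (hne i) ((hs i (i + 1)).2 rfl) with h | h | h
      · exact absurd h.symm (hne _)
      · exact absurd h (hws _)
      · exact h
    have := out_unique hirr hD hk hs (all 0) (all 1)
    exact n1 (by linear_combination this)
  -- the sinks of `V3` having an out-neighbour in the extended cycle
  set M : Set V := {r | r ∈ V3 ∧ (∃ e ∈ E, A r e) ∧ ∀ w ∈ V3, ¬ A r w} with hM
  have H9 : ∀ r ∈ V3, ∀ i e, Twin A s i e → A r e → ∀ r' ∈ V3, A r r' → A r' (s (i + 1)) := by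
    intro r hr i e he hre r' hr' hrr'
    have h2 : A e (s (i + 1)) := (he.2 _).2 rfl
    rcases two hirr hD hre h2 (fun h => ((mem3 r).1 hr).2 (h ▸ sE _)) hrr' with h | h | h
    · exact absurd (h ▸ sE _) ((mem3 r').1 hr').2
    · exact h
    · exact absurd h (no23 _ (sE _) _ hr')
  have H10 : ∀ r ∈ V3, ∀ e ∈ E, A r e → ∀ r' ∈ V3, A r r' → ∀ r'' ∈ V3, ¬ A r' r'' := by
    intro r hr e he hre r' hr' hrr' r'' hr'' hA
    obtain ⟨i, hi⟩ := (memE e).1 he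
    have h1 := H9 r hr i e hi hre r' hr' hrr'
    have h2 := H9 r' hr' _ _ (twin_self hs (i + 1)) h1 r'' hr'' hA
    have key : A r'' e := by
      by_cases hrr : r'' = r
      · rw [hrr]; exact hre
      rcases two hirr hD hrr' hA hrr hre with h | h | h
      · exact absurd (h ▸ he) ((mem3 _).1 hr'').2
      · exact absurd h (no23 _ he _ hr'')
      · exact h
    have := twin_out_unique hirr hD hk hs hi (twin_self hs _) key h2
    exact n2 (by linear_combination -this)
  have H9' : ∀ r ∈ V3, ∀ e ∈ E, A r e → ∀ r' ∈ V3, A r r' → r' ∈ M := by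
    intro r hr e he hre r' hr' hrr'
    obtain ⟨i, hi⟩ := (memE e).1 he
    exact ⟨hr', ⟨_, sE _, H9 r hr i e hi hre r' hr' hrr'⟩, H10 r hr e he hre r' hr' hrr'⟩
  have hsink : ∀ v ∈ M, ∀ w ∈ V3, ¬ A v w := fun v hv => hv.2.2
  have hbase : ∀ v ∈ V3, ∀ m ∈ M, A v m → ∀ o ∈ V3, A v o → o ∈ M := by
    intro v hv m hm hvm o ho hvo
    by_cases hR : ∃ e ∈ E, A v e
    · obtain ⟨e, he, hve⟩ := hR
      exact H9' v hv e he hve o ho hvo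
    obtain ⟨hm3, ⟨e, he, hme⟩, hms⟩ := hm
    have hoe : A o e := by
      rcases two hirr hD hvm hme (fun h => ((mem3 v).1 hv).2 (h ▸ he)) hvo with h | h | h
      · exact absurd (h ▸ he) ((mem3 o).1 ho).2
      · exact h
      · exact absurd h (no23 _ he _ ho)
    refine ⟨ho, ⟨e, he, hoe⟩, ?_⟩
    intro r hr hor
    have hrM := H9' o ho e he hoe r hr hor
    rcases two hirr hD hvo hor (by
      intro h
      exact hR (h ▸ hrM.2.1)) hvm with h | h | h
    · obtain ⟨i, hi⟩ := (memE e).1 he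
      have h1 := H9 o ho i e hi hoe r hr hor
      rw [← h] at h1
      have := twin_out_unique hirr hD hk hs hi (twin_self hs _) hme h1
      exact n1 (by linear_combination -this)
    · exact hms r hr h
    · exact hrM.2.2 m hm3 h
  have Q := lev_step hirr hD (V3 := V3) (M := M) (fun v hv => hv.1) hsink hbase
  have uniq := fun n => lev_uniq hsink n (fun n' _ => Q n')
  have RU : ∀ r ∈ V3, ∀ e ∈ E, A r e → ∃ n, Lev A V3 M n r := by
    intro r hr e he hre
    by_cases h : ∃ w ∈ V3, A r w
    · obtain ⟨w, hw, hrw⟩ := h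
      exact ⟨1, hr, w, hw, hrw, H9' r hr e he hre w hw hrw⟩
    · push Not at h
      exact ⟨0, hr, ⟨e, he, hre⟩, h⟩
  have lev3 : ∀ n v, Lev A V3 M n v → v ∈ V3 := by
    intro n v h
    cases n with
    | zero => exact h.1
    | succ n => exact h.1
  by_cases hall : ∀ v ∈ V3, ∃ n, Lev A V3 M n v
  · left
    refine ⟨V1, E, V3, ?_, ?_, ?_, ?_, clq, fun v hv u hu => (dom21 v hv u hu).1,
      fun u hu v hv => (dom21 v hv u hu).2, no13, ⟨k, hodd, hk, by omega, fun j => {v | Twin A s j v},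
        fun i => ⟨s i, twin_self hs i⟩, ?_, rfl, ?_⟩, no23, ?_⟩
    · rw [Set.disjoint_left]; exact d12
    · rw [Set.disjoint_left]; intro v hv h; exact ((mem3 v).1 h).1 hv
    · rw [Set.disjoint_left]; intro v hv h; exact ((mem3 v).1 h).2 hv
    · exact Set.union_compl_self _
    · intro i j hij
      rw [Set.disjoint_left]
      intro v hv hv'
      apply hij
      have h1 := (hv.2 (i + 1)).2 rfl
      rw [hv'.2] at h1
      exact add_right_cancel h1
    · intro u hu v hv
      constructor
      · intro hA
        obtain ⟨i, hi⟩ := (memE u).1 hu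
        obtain ⟨j, hj⟩ := (memE v).1 hv
        have := (twin_arc hirr hD hk hs hi hj).1 hA
        exact ⟨i, hi, this ▸ hj⟩
      · rintro ⟨i, hi, hj⟩
        exact (twin_arc hirr hD hk hs hi hj).2 rfl
    · refine ⟨{v | ∃ n, Even n ∧ Lev A V3 M n v}, ?_⟩
      have arc : ∀ u ∈ V3, ∀ v ∈ V3, A u v →
          ((∃ n, Even n ∧ Lev A V3 M n u) ↔ ¬ ∃ n, Even n ∧ Lev A V3 M n v) := by
        intro u hu v hv huv
        obtain ⟨n, hn⟩ := hall u hu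
        obtain ⟨m, rfl, hm⟩ := Q n u v hn hv huv
        constructor
        · rintro ⟨a, ha, hla⟩ ⟨b, hb, hlb⟩
          have e1 := uniq _ _ _ hn hla
          have e2 := uniq _ _ _ hm hlb
          subst e1 e2
          rw [Nat.even_add_one] at ha
          exact ha hb
        · intro h
          refine ⟨m + 1, ?_, hn⟩
          rw [Nat.even_add_one]
          exact fun he => h ⟨m, he, hm⟩
      intro u hu v hv huv
      simp only [Set.mem_setOf_eq]
      rcases huv with h | h
      · have h1 := arc u hu v hv h
        rcases Classical.em (∃ n, Even n ∧ Lev A V3 M n u) with p | p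
        · exact Or.inl ⟨p, h1.1 p⟩
        · exact Or.inr ⟨p, by_contra fun q => p (h1.2 q)⟩
      · have h1 := arc v hv u hu h
        rcases Classical.em (∃ n, Even n ∧ Lev A V3 M n v) with p | p
        · exact Or.inr ⟨h1.1 p, p⟩
        · exact Or.inl ⟨by_contra fun q => p (h1.2 q), p⟩
  · right
    push Not at hall
    obtain ⟨z, hz3, hz⟩ := hall
    refine ⟨V1, clq, fun hc => ?_⟩
    have h0 := hc (s 0) (fun h => d12 _ h (sE 0)) z ((mem3 z).1 hz3).1
    have inv : ∀ y, Relation.ReflTransGen (fun x y => x ∈ V1ᶜ ∧ y ∈ V1ᶜ ∧ DAdj A x y) (s 0) y →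
        y ∈ E ∨ ∃ n, Lev A V3 M n y := by
      intro y hy
      induction hy with
      | refl => exact Or.inl (sE 0)
      | @tail x y _ hxy ih =>
        obtain ⟨hx1, hy1, hadj⟩ := hxy
        by_cases hyE : y ∈ E
        · exact Or.inl hyE
        right
        have hy3 : y ∈ V3 := (mem3 y).2 ⟨hy1, hyE⟩
        rcases ih with hx | ⟨n, hn⟩
        · rcases hadj with h | h
          · exact absurd h (no23 x hx y hy3)
          · exact RU y hy3 x hx h
        · rcases hadj with h | h
          · obtain ⟨m, _, hm⟩ := Q n x y hn hy3 h
            exact ⟨m, hm⟩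
          · exact ⟨n + 1, hy3, x, lev3 _ _ hn, h, hn⟩
    rcases inv z h0 with h | ⟨n, h⟩
    · exact ((mem3 z).1 hz3).2 h
    · exact hz n h

end Struct
end ALO
namespace ALO

section Core
variable {A : V → V → Prop}

/-- No vertex is dominated (in the sense of neighbourhoods) by another one. -/
def ND (A : V → V → Prop) : Prop := ∀ u y, u ≠ y → ∃ t, DAdj A t u ∧ t ≠ y ∧ ¬ DAdj A t y

theorem reach_ind {C : V → Prop} {a : V} (h0 : C a) (hstep : ∀ x y, C x → A x y → C y)
    {z : V} (h : Relation.ReflTransGen A a z) : C z := by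
  induction h with
  | refl => exact h0
  | tail _ hxy ih => exact hstep _ _ ih hxy

/-- One step of the invariant for three-cycles. -/
theorem three_step (hirr : Irreflexive A) (hD : ArcLocallyOut A) {a b c z z' : V}
    (hab : A a b) (hbc : A b c) (hca : A c a) (haz : A a z) (hzb : z ≠ b) (hzc : z ≠ c)
    (hzz : A z z') (hza' : z' ≠ a) (hzb' : z' ≠ b) (hzc' : z' ≠ c)
    (na : ¬ A a z') (nb : ¬ A b z') (nc : ¬ A c z') : A z' a ∧ A z' b ∧ A z' c := by
  have P : ∀ {u w y x : V}, A u w → A w y → y ≠ u → A u x → x = y ∨ A x y ∨ A y x :=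
    fun h1 h2 h3 h4 => two hirr hD h1 h2 h3 h4
  have ne : ∀ {p q : V}, A p q → p ≠ q := fun h => ne_of_arc hirr h
  have hb : A z' b := by
    rcases P haz hzz hza' hab with h | h | h
    · exact absurd h.symm hzb'
    · exact absurd h nb
    · exact h
  have hcz : A c z ∨ A z c := by
    rcases P hab hbc (ne hca) haz with h | h | h
    · exact absurd h hzc
    · exact Or.inr h
    · exact Or.inl h
  have ha : A z' a := by
    rcases hcz with h | h
    · rcases P h hzz hzc' hca with h | h | h
      · exact absurd h.symm hza'
      · exact absurd h na
      · exact h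
    · rcases P h hca (ne haz) hzz with h | h | h
      · exact absurd h hza'
      · exact h
      · exact absurd h na
  have hbz : A b z ∨ A z b := by
    rcases hcz with h | h
    · rcases P hca hab (ne hbc) h with h | h | h
      · exact absurd h hzb
      · exact Or.inr h
      · exact Or.inl h
    · rcases P ha haz (ne hzz) hb with h | h | h
      · exact absurd h.symm hzb
      · exact Or.inl h
      · exact Or.inr h
  have hc : A z' c := by
    rcases hbz with h | h
    · rcases P h hzz hzb' hbc with h | h | h
      · exact absurd h.symm hzc'
      · exact absurd h nc
      · exact h
    · rcases P h hbc hzc.symm hzz with h | h | h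
      · exact absurd h hzc'
      · exact h
      · exact absurd h nc
  exact ⟨ha, hb, hc⟩

/-- In a strong digraph a non-neighbour of `c` on the three-cycle `a → b → c → a`
behaves like `c`. -/
theorem three_twin (hirr : Irreflexive A) (hD : ArcLocallyOut A) (hst : IsStrong A) {a b c t : V}
    (hab : A a b) (hbc : A b c) (hca : A c a) (htc : t ≠ c) (hn : ¬ DAdj A t c) :
    A b t ∧ A t a := by
  have P : ∀ {u w y x : V}, A u w → A w y → y ≠ u → A u x → x = y ∨ A x y ∨ A y x :=
    fun h1 h2 h3 h4 => two hirr hD h1 h2 h3 h4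
  have ne : ∀ {p q : V}, A p q → p ≠ q := fun h => ne_of_arc hirr h
  have hJ : (t = a ∨ t = b ∨ t = c) ∨ (A a t ∨ A b t ∨ A c t) ∨ (A t a ∧ A t b ∧ A t c) := by
    refine reach_ind (C := fun t => (t = a ∨ t = b ∨ t = c) ∨ (A a t ∨ A b t ∨ A c t) ∨
      (A t a ∧ A t b ∧ A t c)) (Or.inl (Or.inl rfl)) ?_ (hst a t)
    intro z z' hz hzz
    by_cases h1 : z' = a ∨ z' = b ∨ z' = c
    · exact Or.inl h1
    by_cases h2 : A a z' ∨ A b z' ∨ A c z'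
    · exact Or.inr (Or.inl h2)
    right; right
    push Not at h1 h2
    obtain ⟨e1, e2, e3⟩ := h1
    obtain ⟨m1, m2, m3⟩ := h2
    have nz : z ≠ a ∧ z ≠ b ∧ z ≠ c := by
      refine ⟨?_, ?_, ?_⟩ <;> rintro rfl
      · exact m1 hzz
      · exact m2 hzz
      · exact m3 hzz
    rcases hz with h | h | ⟨ha, hb, hc⟩
    · tauto
    · rcases h with h | h | h
      · exact three_step hirr hD hab hbc hca h nz.2.1 nz.2.2 hzz e1 e2 e3 m1 m2 m3
      · have := three_step hirr hD hbc hca hab h nz.2.2 nz.1 hzz e2 e3 e1 m2 m3 m1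
        exact ⟨this.2.2, this.1, this.2.1⟩
      · have := three_step hirr hD hca hab hbc h nz.1 nz.2.1 hzz e3 e1 e2 m3 m1 m2
        exact ⟨this.2.1, this.2.2, this.1⟩
    · have q1 := P hc hca nz.1.symm hzz
      have q2 := P ha hab nz.2.1.symm hzz
      have q3 := P hb hbc nz.2.2.symm hzz
      refine ⟨?_, ?_, ?_⟩ <;> tauto
  have hn1 : ¬ A t c := fun h => hn (Or.inl h)
  have hn2 : ¬ A c t := fun h => hn (Or.inr h)
  have hat : ¬ A a t := by
    intro h
    rcases P hab hbc (ne hca) h with h | h | h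
    · exact htc h
    · exact hn1 h
    · exact hn2 h
  have hta : t ≠ a := by rintro rfl; exact hn2 hca
  have htb : t ≠ b := by rintro rfl; exact hn1 hbc
  have hbt : A b t := by tauto
  refine ⟨hbt, ?_⟩
  rcases P hbc hca (ne hab) hbt with h | h | h
  · exact absurd h hta
  · exact h
  · exact absurd h hat

theorem no_three (hirr : Irreflexive A) (hD : ArcLocallyOut A) (hst : IsStrong A) (hnd : ND A)
    {a b c : V} (hab : A a b) (hbc : A b c) (hca : A c a) : False := by
  have P : ∀ {u w y x : V}, A u w → A w y → y ≠ u → A u x → x = y ∨ A x y ∨ A y x :=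
    fun h1 h2 h3 h4 => two hirr hD h1 h2 h3 h4
  have ne : ∀ {p q : V}, A p q → p ≠ q := fun h => ne_of_arc hirr h
  obtain ⟨t, _, htc, hn⟩ := hnd a c (ne hca).symm
  obtain ⟨hbt, hta⟩ := three_twin hirr hD hst hab hbc hca htc hn
  obtain ⟨x, hxc, hxt, hxn⟩ := hnd c t htc.symm
  obtain ⟨hbx, hxa⟩ := three_twin hirr hD hst hab hbt hta hxt hxn
  rcases hxc with h | h
  · rcases P hbx h (ne hbc).symm hbt with h | h
    · exact htc h
    · exact hn h
  · rcases P hbc h (ne hbx).symm hbt with h | h | h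
    · exact hxt h.symm
    · exact hxn (Or.inr h)
    · exact hxn (Or.inl h)

theorem no_trans (hirr : Irreflexive A) (hD : ArcLocallyOut A) (hst : IsStrong A) (hnd : ND A)
    {u w q : V} (huw : A u w) (hwq : A w q) (huq : A u q) : False := by
  have P : ∀ {u w y x : V}, A u w → A w y → y ≠ u → A u x → x = y ∨ A x y ∨ A y x :=
    fun h1 h2 h3 h4 => two hirr hD h1 h2 h3 h4
  have ne : ∀ {p q : V}, A p q → p ≠ q := fun h => ne_of_arc hirr h
  have no3 : ∀ {a b c : V}, A a b → A b c → A c a → False :=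
    fun h1 h2 h3 => no_three hirr hD hst hnd h1 h2 h3
  let N : V → Prop := fun z => z = q ∨ A z q ∨ A q z
  -- out-neighbours of out-neighbours of `q`
  have star : ∀ y z, A q y → A y z → N z := by
    intro y z hqy hyz
    by_cases hyu : y = u
    · subst hyu; exact P huw hwq (ne huq).symm hyz
    by_cases hyw : y = w
    · subst hyw
      by_cases hzu : z = u
      · rw [hzu]; exact Or.inr (Or.inl huq)
      · rcases P huw hyz hzu huq with h | h | h
        · exact Or.inl h.symm
        · exact Or.inr (Or.inr h)
        · exact Or.inr (Or.inl h)
    rcases P huq hqy hyu huw with h | h | h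
    · exact absurd h.symm hyw
    · by_cases hzw : z = w
      · rw [hzw]; exact Or.inr (Or.inl hwq)
      · rcases P h hyz hzw hwq with h | h | h
        · exact Or.inl h.symm
        · exact Or.inr (Or.inr h)
        · exact Or.inr (Or.inl h)
    · exact (no3 hwq hqy h).elim
  have all : ∀ z, N z ∧ ∀ z', A z z' → N z' := by
    intro z
    refine reach_ind (C := fun z => N z ∧ ∀ z', A z z' → N z') ?_ ?_ (hst u z)
    · exact ⟨Or.inr (Or.inl huq), fun z' h => P huw hwq (ne huq).symm h⟩
    · rintro p y ⟨hp, hpo⟩ hpy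
      have hy := hpo y hpy
      refine ⟨hy, fun z hyz => ?_⟩
      by_cases hzp : z = p
      · rw [hzp]; exact hp
      rcases hp with hp | hp | hp
      · subst hp; exact star y z hpy hyz
      · rcases P hpy hyz hzp hp with h | h | h
        · exact Or.inl h.symm
        · exact Or.inr (Or.inr h)
        · exact Or.inr (Or.inl h)
      · rcases hy with hy | hy | hy
        · subst hy; exact Or.inr (Or.inr hyz)
        · exact (no3 hp hpy hy).elim
        · exact star y z hy hyz
  obtain ⟨t, _, htq, hn⟩ := hnd u q (ne huq)
  rcases (all t).1 with h | h
  · exact htq h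
  · exact hn h

theorem tri_free (hirr : Irreflexive A) (hD : ArcLocallyOut A) (hst : IsStrong A) (hnd : ND A)
    {a b c : V} (hab : DAdj A a b) (hbc : DAdj A b c) (hac : DAdj A a c) : False := by
  have no3 : ∀ {a b c : V}, A a b → A b c → A c a → False :=
    fun h1 h2 h3 => no_three hirr hD hst hnd h1 h2 h3
  have noT : ∀ {a b c : V}, A a b → A b c → A a c → False :=
    fun h1 h2 h3 => no_trans hirr hD hst hnd h1 h2 h3
  rcases hab with h1 | h1 <;> rcases hbc with h2 | h2 <;> rcases hac with h3 | h3
  · exact noT h1 h2 h3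
  · exact no3 h1 h2 h3
  · exact noT h3 h2 h1
  · exact noT h3 h1 h2
  · exact noT h1 h3 h2
  · exact noT h2 h3 h1
  · exact no3 h3 h2 h1
  · exact noT h2 h1 h3

/-- The main structural dichotomy for undominated connected digraphs. -/
theorem core [Finite V] (hirr : Irreflexive A) (hD : ArcLocallyOut A) (hnd : ND A)
    (hconn : ∀ Z : Set V, Z.Nonempty → (∀ x ∈ Z, ∀ y, DAdj A x y → y ∈ Z) → Z = Set.univ) :
    (∃ T : Set V, ∀ u v, A u v → (u ∈ T ↔ v ∉ T)) ∨ IsStrong A := by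
  have P : ∀ {u w y x : V}, A u w → A w y → y ≠ u → A u x → x = y ∨ A x y ∨ A y x :=
    fun h1 h2 h3 h4 => two hirr hD h1 h2 h3 h4
  have ne : ∀ {p q : V}, A p q → p ≠ q := fun h => ne_of_arc hirr h
  have dom : ∀ u y, u ≠ y → (∀ t, DAdj A t u → t = y ∨ DAdj A t y) → False := by
    intro u y huy h
    obtain ⟨t, h1, h2, h3⟩ := hnd u y huy
    rcases h t h1 with h4 | h4
    · exact h2 h4
    · exact h3 h4
  have pre : ∀ {u w y : V}, A u w → A w y → y ≠ u → ∃ t, A t u := by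
    intro u w y h1 h2 h3
    by_contra hno
    push Not at hno
    refine dom u y h3.symm (fun t ht => ?_)
    rcases ht with ht | ht
    · exact absurd ht (hno t)
    · exact P h1 h2 h3 ht
  by_cases h2w : ∃ u w y, A u w ∧ A w y ∧ y ≠ u
  swap
  · left
    push Not at h2w
    refine ⟨{v | ∃ w, A v w}, fun u v huv => ⟨fun _ => ?_, fun _ => ⟨v, huv⟩⟩⟩
    rintro ⟨y, hy⟩
    have e : y = u := h2w u v y huv hy
    subst e
    refine dom y v (ne huv) (fun t ht => Or.inl ?_)
    rcases ht with ht | ht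
    · exact (h2w t y v ht huv).symm
    · exact h2w v y t hy ht
  obtain ⟨u, w, y, huw, hwy, hyu⟩ := h2w
  -- an initial strong component from which `u` is reachable
  let anc : V → Set V := fun x => {z | Relation.ReflTransGen A z x}
  obtain ⟨s, hs, hmin⟩ : ∃ s, s ∈ anc u ∧ ∀ x ∈ anc u, (anc s).ncard ≤ (anc x).ncard := by
    obtain ⟨s, hs, h⟩ := Set.exists_min_image (anc u) (fun x => (anc x).ncard) (Set.toFinite _)
      ⟨u, Relation.ReflTransGen.refl⟩
    exact ⟨s, hs, h⟩
  have back : ∀ z ∈ anc s, Relation.ReflTransGen A s z := by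
    intro z hz
    have hsub : anc z ⊆ anc s := fun x hx => Relation.ReflTransGen.trans hx hz
    have := Set.eq_of_subset_of_ncard_le hsub (hmin z (Relation.ReflTransGen.trans hz hs))
      (Set.toFinite _)
    have h : s ∈ anc z := by rw [this]; exact Relation.ReflTransGen.refl
    exact h
  set S : Set V := anc s with hS
  have sS : s ∈ S := Relation.ReflTransGen.refl
  have init : ∀ z x, A z x → x ∈ S → z ∈ S := fun z x h hx => Relation.ReflTransGen.head h hx
  have spred : ∃ t, A t s := by
    rcases Relation.ReflTransGen.cases_head hs with h | ⟨a, hsa, hau⟩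
    · subst h; exact pre huw hwy hyu
    · obtain ⟨b, hab⟩ : ∃ b, A a b := by
        rcases Relation.ReflTransGen.cases_head hau with h | ⟨b, hab, _⟩
        · subst h; exact ⟨w, huw⟩
        · exact ⟨b, hab⟩
      by_cases hbs : b = s
      · exact ⟨a, hbs ▸ hab⟩
      · exact pre hsa hab hbs
  -- reachability inside `S`
  have ind : ∀ (C : V → Prop) (x : V), x ∈ S → C x →
      (∀ p q, p ∈ S → q ∈ S → C p → A p q → C q) → ∀ z ∈ S, C z := by
    intro C x hx hCx hstep z hz
    have hxz : Relation.ReflTransGen A x z := Relation.ReflTransGen.trans hx (back z hz)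
    have : z ∈ S → C z := by
      clear hz
      induction hxz with
      | refl => exact fun _ => hCx
      | @tail p q _ hpq ih =>
        intro hq
        have hp := init p q hpq hq
        exact hstep p q hp hq (ih hp) hpq
    exact this hz
  have succS : ∀ x ∈ S, ∃ x' ∈ S, A x x' := by
    intro x hx
    have hxs : Relation.ReflTransGen A x s := hx
    rcases Relation.ReflTransGen.cases_head hxs with h | ⟨a, hxa, has⟩
    · obtain ⟨t, ht⟩ := spred
      have htS := init t s ht sS
      have hst := back t htS
      rcases Relation.ReflTransGen.cases_head hst with h' | ⟨a, hsa, hat⟩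
      · exact absurd h'.symm (ne ht)
      · refine ⟨a, ?_, h ▸ hsa⟩
        exact Relation.ReflTransGen.trans hat htS
    · exact ⟨a, has, hxa⟩
  have two' : ∀ v, v ∉ S → ∀ x x' x'', x'' ∈ S → A x v → A x x' → A x' x'' → A x'' v := by
    intro v hv x x' x'' hx'' hxv hxx hxx'
    by_cases e : x'' = x
    · rw [e]; exact hxv
    rcases P hxx hxx' e hxv with h | h | h
    · exact absurd (h ▸ hx'') hv
    · exact absurd (init _ _ h hx'') hv
    · exact h
  -- no outside vertex is dominated by all of `S`
  have caseA : ∀ v, v ∉ S → ¬ ∀ x ∈ S, A x v := by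
    intro v hv hall
    refine dom s v (fun e => hv (e ▸ sS)) (fun t ht => ?_)
    by_cases htS : t ∈ S
    · exact Or.inr (Or.inl (hall t htS))
    rcases ht with ht | ht
    · exact absurd (init _ _ ht sS) htS
    · obtain ⟨x', hx', hsx⟩ := succS s sS
      exact P hsx (hall x' hx') (fun e => hv (e ▸ sS)) ht
  have caseB : ∀ v, v ∉ S → ∀ x ∈ S, ¬ A x v := by
    intro v hv x0 hx0 hx0v
    have nX : ∀ x x', x ∈ S → x' ∈ S → A x v → A x x' → ¬ A x' v := by
      intro x x' hx hx' hxv hxx hx'v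
      apply caseA v hv
      intro z hz
      refine (ind (fun z => A z v ∧ ∀ z' ∈ S, A z z' → A z' v) x' hx'
        ⟨hx'v, fun z' hz' h => two' v hv x x' z' hz' hxv hxx h⟩ ?_ z hz).1
      rintro p q hp hq ⟨hpv, hpo⟩ hpq
      exact ⟨hpo q hq hpq, fun z' hz' h => two' v hv p q z' hz' hpv hpq h⟩
    have nY : ∀ z ∈ S, A z v ∨ ∀ z' ∈ S, A z z' → A z' v := by
      refine ind (fun z => A z v ∨ ∀ z' ∈ S, A z z' → A z' v) x0 hx0 (Or.inl hx0v) ?_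
      intro p q hp hq hC hpq
      rcases hC with h | h
      · exact Or.inr (fun z' hz' h' => two' v hv p q z' hz' h hpq h')
      · exact Or.inl (h q hq hpq)
    -- arcs in `S` go between the two sides
    have bip : ∀ p q, p ∈ S → q ∈ S → A p q → (A p v ↔ ¬ A q v) := by
      intro p q hp hq hpq
      constructor
      · exact fun h => nX p q hp hq h hpq
      · intro h
        rcases nY p hp with h' | h'
        · exact h'
        · exact absurd (h' q hq hpq) h
    -- each side behaves uniformly
    have unif : ∀ v', v' ∉ S → ∀ x1 ∈ S, A x1 v' → ∀ z ∈ S, (A z v ↔ A x1 v) → A z v' := by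
      intro v' hv' x1 hx1 h1 z hz hzs
      refine (ind (fun z => ((A z v ↔ A x1 v) → A z v') ∧
        (¬ (A z v ↔ A x1 v) → ∀ z' ∈ S, A z z' → A z' v')) x1 hx1 ⟨fun _ => h1, fun h => (h Iff.rfl).elim⟩
        ?_ z hz).1 hzs
      rintro p q hp hq ⟨hC1, hC2⟩ hpq
      have hb := bip p q hp hq hpq
      constructor
      · intro h
        exact hC2 (by tauto) q hq hpq
      · intro h z' hz' hqz
        exact two' v' hv' p q z' hz' (hC1 (by tauto)) hpq hqz
    obtain ⟨y0, hy0, hxy0⟩ := succS x0 hx0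
    have hy0v : ¬ A y0 v := (bip _ _ hx0 hy0 hxy0).1 hx0v
    by_cases hW : ∃ v', v' ∉ S ∧ ∃ y1 ∈ S, ¬ A y1 v ∧ A y1 v'
    · obtain ⟨w', hw', y1, hy1, hy1v, hy1w⟩ := hW
      have hYw : ∀ z ∈ S, ¬ A z v → A z w' := fun z hz h =>
        unif w' hw' y1 hy1 hy1w z hz (by tauto)
      refine dom x0 w' (fun e => hw' (e ▸ hx0)) (fun t ht => ?_)
      by_cases htS : t ∈ S
      · refine Or.inr (Or.inl (hYw t htS ?_))
        rcases ht with ht | ht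
        · have := bip _ _ htS hx0 ht; tauto
        · have := bip _ _ hx0 htS ht; tauto
      · rcases ht with ht | ht
        · exact absurd (init _ _ ht hx0) htS
        · exact P hxy0 (hYw y0 hy0 hy0v) (fun e => hw' (e ▸ hx0)) ht
    · push Not at hW
      refine dom y0 v (fun e => hv (e ▸ hy0)) (fun t ht => ?_)
      by_cases htS : t ∈ S
      · refine Or.inr (Or.inl ?_)
        rcases ht with ht | ht
        · have := bip _ _ htS hy0 ht; tauto
        · have := bip _ _ hy0 htS ht; tauto
      · rcases ht with ht | ht
        · exact absurd (init _ _ ht hy0) htS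
        · exact absurd ht (hW t htS y0 hy0 hy0v)
  have hSu : S = Set.univ := by
    refine hconn S ⟨s, sS⟩ (fun x hx y hxy => ?_)
    rcases hxy with h | h
    · by_contra hy
      exact caseB y hy x hx h
    · exact init _ _ h hx
  right
  intro a b
  have ha : a ∈ S := hSu ▸ Set.mem_univ a
  have hb : b ∈ S := hSu ▸ Set.mem_univ b
  exact Relation.ReflTransGen.trans ha (back b hb)

end Core
end ALO
namespace ALO

section Hole2

theorem odd_hole {W : Type*} (G : SimpleGraph W)
    (htri : ∀ a b c, G.Adj a b → G.Adj b c → G.Adj a c → False) (hcol : ¬ G.Colorable 2) :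
    ∃ k : ℕ, Odd k ∧ 5 ≤ k ∧ ∃ s : ZMod k → W, ∀ i j, G.Adj (s i) (s j) ↔ (j = i + 1 ∨ i = j + 1) := by
  classical
  rw [SimpleGraph.two_colorable_iff_forall_loop_even] at hcol
  push Not at hcol
  obtain ⟨u0, w0, hw0⟩ := hcol
  have hex : ∃ k : ℕ, Odd k ∧ ∃ u, ∃ p : G.Walk u u, p.length = k :=
    ⟨w0.length, Nat.not_even_iff_odd.1 hw0, u0, w0, rfl⟩
  obtain ⟨hodd, u, p, hp⟩ := Nat.find_spec hex
  have hmin : ∀ v, ∀ q : G.Walk v v, Odd q.length → Nat.find hex ≤ q.length :=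
    fun v q hq => Nat.find_min' hex ⟨hq, v, q, rfl⟩
  generalize Nat.find hex = k at *
  have key : ∀ i j : ℕ, i ≤ j → j ≤ k → ∀ q : G.Walk (p.getVert i) (p.getVert j),
      (Odd (i + q.length + (k - j)) → k ≤ i + q.length + (k - j)) ∧
      (Odd (j - i + q.length) → k ≤ j - i + q.length) := by
    intro i j hij hjk q
    constructor
    · intro ho
      have := hmin u ((p.take i).append (q.append (p.drop j)))
      simp only [SimpleGraph.Walk.length_append, SimpleGraph.Walk.take_length,
        SimpleGraph.Walk.drop_length, hp] at this
      have e : min i k + (q.length + (k - j)) = i + q.length + (k - j) := by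
        rw [min_eq_left (by omega)]; ring
      rw [e] at this
      exact this ho
    · intro ho
      have e : (p.drop i).getVert (j - i) = p.getVert j := by
        rw [SimpleGraph.Walk.drop_getVert]; congr 1; omega
      have := hmin _ ((((p.drop i).take (j - i)).copy rfl e).append q.reverse)
      simp only [SimpleGraph.Walk.length_append, SimpleGraph.Walk.take_length,
        SimpleGraph.Walk.drop_length, hp, SimpleGraph.Walk.length_copy,
        SimpleGraph.Walk.length_reverse] at this
      have e : min (j - i) (k - i) + q.length = j - i + q.length := by
        rw [min_eq_left (by omega)]
      rw [e] at this
      exact this ho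
  have pos : 0 < k := hodd.pos
  have : NeZero k := ⟨by omega⟩
  have adjs : ∀ i, i < k → G.Adj (p.getVert i) (p.getVert (i + 1)) := fun i hi =>
    p.adj_getVert_succ (by omega)
  have hend : p.getVert k = p.getVert 0 := by
    rw [SimpleGraph.Walk.getVert_zero, ← hp, SimpleGraph.Walk.getVert_length]
  have hk5 : 5 ≤ k := by
    by_contra hlt
    have : k = 1 ∨ k = 3 := by
      obtain ⟨m, hm⟩ := hodd
      omega
    rcases this with h | h
    · subst h
      have := adjs 0 (by omega)
      rw [zero_add, hend] at this
      exact G.loopless.irrefl _ this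
    · subst h
      have h1 := adjs 0 (by omega)
      have h2 := adjs 1 (by omega)
      have h3 := adjs 2 (by omega)
      norm_num at h1 h2 h3
      rw [hend] at h3
      rw [SimpleGraph.Walk.getVert_zero] at h3
      exact htri _ _ _ h1 h2 h3.symm
  refine ⟨k, hodd, hk5, fun x => p.getVert x.val, ?_⟩
  have fwd : ∀ x : ZMod k, G.Adj (p.getVert x.val) (p.getVert (x + 1).val) := by
    intro x
    have hx := ZMod.val_lt x
    have h1 := adjs x.val hx
    have e : (x + 1).val = (x.val + 1) % k := by
      rw [ZMod.val_add, ZMod.val_one'' (by omega)]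
    rw [e]
    by_cases hlt : x.val + 1 < k
    · rw [Nat.mod_eq_of_lt hlt]; exact h1
    · have : x.val + 1 = k := by omega
      rw [this] at h1 ⊢
      rw [Nat.mod_self, ← hend]; exact h1
  have castv : ∀ x : ZMod k, ((x.val : ℕ) : ZMod k) = x := fun x => ZMod.natCast_zmod_val x
  have bwd : ∀ x y : ZMod k, x.val ≤ y.val → G.Adj (p.getVert x.val) (p.getVert y.val) →
      y = x + 1 ∨ x = y + 1 := by
    intro x y hxy hadj
    have hy := ZMod.val_lt y
    have := key x.val y.val hxy hy.le hadj.toWalk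
    simp only [SimpleGraph.Walk.length_cons, SimpleGraph.Walk.length_nil] at this
    obtain ⟨h1, h2⟩ := this
    have hcase : y.val = x.val + 1 ∨ (x.val = 0 ∧ y.val + 1 = k) := by
      rw [Nat.odd_iff] at h1 h2 hodd
      omega
    rcases hcase with h | ⟨h0, h⟩
    · left
      rw [← castv y, h]; push_cast; rw [castv]
    · right
      rw [← castv x, h0, ← castv y]
      have : ((y.val + 1 : ℕ) : ZMod k) = 0 := by rw [h]; simp
      push_cast at this ⊢
      exact this.symm
  intro x y
  constructor
  · intro h
    rcases le_total x.val y.val with hle | hle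
    · exact bwd x y hle h
    · exact (bwd y x hle h.symm).symm
  · rintro (rfl | rfl)
    · exact fwd x
    · exact (fwd y).symm

variable {A : V → V → Prop} {k : ℕ}

theorem all_of_pred [NeZero k] (C : ZMod k → Prop) (j : ZMod k) (h0 : C j)
    (h : ∀ i, C (i + 1) → C i) (i : ZMod k) : C i := by
  have h1 : ∀ n : ℕ, C (j - (n : ZMod k)) := by
    intro n
    induction n with
    | zero => simpa using h0
    | succ n ih =>
      apply h
      have e : j - ((n + 1 : ℕ) : ZMod k) + 1 = j - n := by push_cast; ring
      rwa [e]
  have := h1 (j - i).val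
  rwa [ZMod.natCast_zmod_val, sub_sub_cancel] at this

/-- An induced odd cycle of length at least five is a directed cycle. -/
theorem orient (hD : ArcLocallyOut A) (hk : 5 ≤ k) (hodd : Odd k)
    {s : ZMod k → V} (hs : ∀ i j, DAdj A (s i) (s j) ↔ (j = i + 1 ∨ i = j + 1)) :
    ∃ s' : ZMod k → V, Hole A s' := by
  obtain ⟨n1, n2, n3, n4⟩ := small_ne hk
  have : NeZero k := ⟨by omega⟩
  have inj : ∀ i j, i ≠ j → s i ≠ s j := by
    intro i j hij h
    have h1 : DAdj A (s j) (s (i + 1)) := by rw [← h, hs]; exact Or.inl rfl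
    have h2 : DAdj A (s j) (s (i - 1)) := by rw [← h, hs]; right; ring
    rw [hs] at h1 h2
    rcases h1 with h1 | h1
    · exact hij (add_right_cancel h1)
    · rcases h2 with h2 | h2
      · exact n4 (by linear_combination -h1 - h2)
      · exact hij (by linear_combination -h2)
  have alo : ∀ a b c d : ZMod k, a ≠ b → a ≠ c → a ≠ d → b ≠ c → b ≠ d → c ≠ d →
      A (s b) (s a) → A (s b) (s c) → A (s c) (s d) → (d = a + 1 ∨ a = d + 1) := by
    intro a b c d h1 h2 h3 h4 h5 h6 g1 g2 g3
    exact (hs a d).1 (hD _ _ _ _ (inj _ _ h1) (inj _ _ h2) (inj _ _ h3) (inj _ _ h4) (inj _ _ h5)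
      (inj _ _ h6) g1 g2 g3)
  have fb : ∀ i, A (s i) (s (i + 1)) ∨ A (s (i + 1)) (s i) := fun i => (hs i (i + 1)).2 (Or.inl rfl)
  have F : ∀ i, A (s (i + 1)) (s i) → A (s (i + 1)) (s (i + 2)) → A (s (i + 2)) (s (i + 3)) →
      False := by
    intro i h1 h2 h3
    rcases alo i (i + 1) (i + 2) (i + 3) (fun h => n1 (by linear_combination -h))
      (fun h => n2 (by linear_combination -h)) (fun h => n3 (by linear_combination -h))
      (fun h => n1 (by linear_combination -h)) (fun h => n2 (by linear_combination -h))
      (fun h => n1 (by linear_combination -h)) h1 h2 h3 with h | h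
    · exact n2 (by linear_combination h)
    · exact n4 (by linear_combination -h)
  have B : ∀ i, A (s (i + 2)) (s (i + 3)) → A (s (i + 2)) (s (i + 1)) → A (s (i + 1)) (s i) →
      False := by
    intro i h1 h2 h3
    rcases alo (i + 3) (i + 2) (i + 1) i (fun h => n1 (by linear_combination h))
      (fun h => n2 (by linear_combination h)) (fun h => n3 (by linear_combination h))
      (fun h => n1 (by linear_combination h)) (fun h => n2 (by linear_combination h))
      (fun h => n1 (by linear_combination h)) h1 h2 h3 with h | h
    · exact n4 (by linear_combination -h)
    · exact n2 (by linear_combination h)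
  have e12 : ∀ i : ZMod k, i + 1 + 1 = i + 2 := fun i => by ring
  have e23 : ∀ i : ZMod k, i + 2 + 1 = i + 3 := fun i => by ring
  by_cases hF : ∃ i, A (s i) (s (i + 1)) ∧ A (s (i + 1)) (s (i + 2))
  · obtain ⟨i, hi⟩ := hF
    have all : ∀ i, A (s i) (s (i + 1)) ∧ A (s (i + 1)) (s (i + 2)) := by
      refine all_of_pred _ i hi ?_
      intro j hj
      have h3 : j + 1 + 2 = j + 3 := by ring
      rw [e12, h3] at hj
      refine ⟨?_, hj.1⟩
      rcases fb j with h | h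
      · exact h
      · exact (F j h hj.1 hj.2).elim
    have pure : ∀ i, ¬ A (s (i + 1)) (s i) := by
      intro i h
      have h2 := (all (i + 2)).1
      rw [e23] at h2
      exact F i h (all i).2 h2
    refine ⟨s, fun i j => ⟨fun h => ?_, fun h => h ▸ (all i).1⟩⟩
    rcases (hs i j).1 (Or.inl h) with h' | h'
    · exact h'
    · subst h'; exact absurd h (pure j)
  by_cases hB : ∃ i, A (s (i + 1)) (s i) ∧ A (s (i + 2)) (s (i + 1))
  · obtain ⟨i, hi⟩ := hB
    have stp : ∀ j, (A (s (j + 1)) (s j) ∧ A (s (j + 2)) (s (j + 1))) →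
        (A (s (j + 2)) (s (j + 1)) ∧ A (s (j + 3)) (s (j + 2))) ∧ ¬ A (s (j + 2)) (s (j + 3)) := by
      intro j hj
      have hno : ¬ A (s (j + 2)) (s (j + 3)) := fun h => B j h hj.2 hj.1
      have := fb (j + 2)
      rw [e23] at this
      exact ⟨⟨hj.2, this.resolve_left hno⟩, hno⟩
    have all : ∀ i, A (s (i + 1)) (s i) ∧ A (s (i + 2)) (s (i + 1)) := by
      have := all_of_pred (fun i => A (s (-i + 1)) (s (-i)) ∧ A (s (-i + 2)) (s (-i + 1))) (-i)
        (by simpa using hi) (by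
          intro j hj
          have := (stp _ hj).1
          have e1 : -(j + 1) + 2 = -j + 1 := by ring
          have e2 : -(j + 1) + 1 = -j := by ring
          have e3 : -(j + 1) + 3 = -j + 2 := by ring
          rw [e1, e2, e3] at this
          exact this)
      intro i
      simpa using this (-i)
    have pure : ∀ i, ¬ A (s i) (s (i + 1)) := by
      intro i h
      have h2 := (stp _ (all (i - 2))).2
      have e1 : i - 2 + 2 = i := by ring
      have e2 : i - 2 + 3 = i + 1 := by ring
      rw [e1, e2] at h2
      exact h2 h
    refine ⟨fun i => s (-i), fun i j => ⟨fun h => ?_, fun h => ?_⟩⟩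
    · change A (s (-i)) (s (-j)) at h
      rcases (hs (-i) (-j)).1 (Or.inl h) with h' | h'
      · rw [h'] at h; exact absurd h (pure _)
      · linear_combination h'
    · have := (all (-j)).1
      have e : -j + 1 = -i := by rw [h]; ring
      change A (s (-i)) (s (-j))
      rwa [e] at this
  · exfalso
    push Not at hF hB
    have alt : ∀ i, A (s i) (s (i + 1)) ↔ ¬ A (s (i + 1)) (s (i + 2)) := by
      intro i
      constructor
      · exact hF i
      · intro h
        have h1 := fb (i + 1)
        rw [e12] at h1
        rcases fb i with h2 | h2
        · exact h2
        · exact absurd (h1.resolve_left h) (hB i h2)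
    have alt2 : ∀ i, A (s i) (s (i + 1)) → A (s (i + 2)) (s (i + 2 + 1)) := by
      intro i h
      have h1 := alt i
      have h2 := alt (i + 1)
      have e : i + 1 + 2 = i + 2 + 1 := by ring
      rw [e12, e] at h2
      tauto
    by_cases h0 : A (s 0) (s (0 + 1))
    · have h1 := step_two hodd (fun i => A (s i) (s (i + 1))) 0 h0 alt2
      have h2 := h1 (0 + 1)
      rw [e12] at h2
      exact (alt 0).1 (h1 0) h2
    · have h2 : A (s (0 + 1)) (s (0 + 2)) := by
        by_contra h; exact h0 ((alt 0).2 h)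
      rw [← e12 0] at h2
      exact h0 (step_two hodd (fun i => A (s i) (s (i + 1))) _ h2 alt2 0)

end Hole2
end ALO
namespace ALO

section Colour
variable {A : V → V → Prop}

/-- A proper colouring of `S` with colours `0, …, n-1`. -/
def Col (A : V → V → Prop) (S : Finset V) (n : ℕ) : Prop :=
  ∃ f : V → ℕ, (∀ x ∈ S, f x < n) ∧ ∀ u ∈ S, ∀ v ∈ S, DAdj A u v → f u ≠ f v

/-- All cliques in `S` have at most `n` vertices. -/
def CliqueLe (A : V → V → Prop) (S : Finset V) (n : ℕ) : Prop :=
  ∀ K : Finset V, K ⊆ S → (∀ u ∈ K, ∀ v ∈ K, u ≠ v → DAdj A u v) → K.card ≤ n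

theorem DAdj_symm {u v : V} (h : DAdj A u v) : DAdj A v u := Or.symm h

theorem CliqueLe.mono {S T : Finset V} {n : ℕ} (h : CliqueLe A S n) (hT : T ⊆ S) :
    CliqueLe A T n := fun K hK hc => h K (hK.trans hT) hc

open Classical in
theorem col_dom {S : Finset V} {n : ℕ} (hirr : Irreflexive A) (hcl : CliqueLe A S n)
    (ih : ∀ T : Finset V, T ⊂ S → ∀ m, CliqueLe A T m → Col A T m)
    {u y : V} (hu : u ∈ S) (hy : y ∈ S) (huy : u ≠ y)
    (hdom : ∀ t ∈ S, DAdj A t u → t = y ∨ DAdj A t y) : Col A S n := by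
  have hne : ∀ {p q : V}, DAdj A p q → p ≠ q := by
    rintro p q (h | h) e <;> subst e <;> exact hirr p h
  obtain ⟨f, hf1, hf2⟩ := ih (S.erase u) (Finset.erase_ssubset hu) n
    (hcl.mono (Finset.erase_subset _ _))
  have hyE : y ∈ S.erase u := Finset.mem_erase.2 ⟨huy.symm, hy⟩
  by_cases hadj : DAdj A u y
  · obtain ⟨m, rfl⟩ : ∃ m, n = m + 1 := ⟨n - 1, by have := hf1 y hyE; omega⟩
    set C : Finset V := (S.erase u).filter (fun x => f x = f y) with hC
    have hCm : ∀ x, x ∈ C ↔ (x ≠ u ∧ x ∈ S) ∧ f x = f y := by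
      intro x; rw [hC, Finset.mem_filter, Finset.mem_erase]
    have hyC : y ∈ C := (hCm y).2 ⟨⟨huy.symm, hy⟩, rfl⟩
    have hcl' : CliqueLe A (S \ C) m := by
      intro K hK hc
      by_contra hcon
      have hKS : K ⊆ S := hK.trans Finset.sdiff_subset
      have hyK : y ∉ K := fun h => (Finset.mem_sdiff.1 (hK h)).2 hyC
      by_cases huK : u ∈ K
      · have := hcl (insert y K) (Finset.insert_subset hy hKS) (by
          have key : ∀ a ∈ K, DAdj A a y := by
            intro a ha
            by_cases hau : a = u
            · subst hau; exact hadj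
            · rcases hdom a (hKS ha) (hc a ha u huK hau) with h | h
              · subst h; exact absurd ha hyK
              · exact h
          intro a ha b hb hab
          rcases Finset.mem_insert.1 ha with e1 | h1 <;>
            rcases Finset.mem_insert.1 hb with e2 | h2
          · exact absurd (e1.trans e2.symm) hab
          · rw [e1]; exact DAdj_symm (key b h2)
          · rw [e2]; exact key a h1
          · exact hc a h1 b h2 hab)
        rw [Finset.card_insert_of_notMem hyK] at this
        omega
      · have hKE : ∀ a ∈ K, a ∈ S.erase u := fun a ha =>
          Finset.mem_erase.2 ⟨fun e => huK (e ▸ ha), hKS ha⟩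
        have hinj : Set.InjOn f (K : Set V) := by
          intro a ha b hb hab
          by_contra hne'
          exact hf2 a (hKE a ha) b (hKE b hb) (hc a ha b hb hne') hab
        have hsub : K.image f ⊆ (Finset.range (m + 1)).erase (f y) := by
          intro c hc'
          obtain ⟨a, ha, rfl⟩ := Finset.mem_image.1 hc'
          refine Finset.mem_erase.2 ⟨fun e => ?_, Finset.mem_range.2 (hf1 a (hKE a ha))⟩
          exact (Finset.mem_sdiff.1 (hK ha)).2
            ((hCm a).2 ⟨⟨fun e => huK (e ▸ ha), hKS ha⟩, e⟩)
        have := Finset.card_le_card hsub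
        rw [Finset.card_image_of_injOn hinj,
          Finset.card_erase_of_mem (Finset.mem_range.2 (hf1 y hyE)), Finset.card_range] at this
        omega
    obtain ⟨g, hg1, hg2⟩ := ih (S \ C) (by
      refine ⟨Finset.sdiff_subset, fun h => ?_⟩
      exact (Finset.mem_sdiff.1 (h hy)).2 hyC) m hcl'
    refine ⟨fun x => if x ∈ C then m else g x, ?_, ?_⟩
    · intro x hx
      by_cases h : x ∈ C
      · simp [h]
      · have := hg1 x (Finset.mem_sdiff.2 ⟨hx, h⟩)
        simp only [h, if_false]; omega
    · intro a ha b hb hab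
      by_cases h : a ∈ C <;> by_cases h' : b ∈ C <;> simp only [h, h', if_true, if_false]
      · exfalso
        have h1 := (hCm a).1 h
        have h2 := (hCm b).1 h'
        exact hf2 a (Finset.mem_erase.2 h1.1) b (Finset.mem_erase.2 h2.1) hab
          (h1.2.trans h2.2.symm)
      · have := hg1 b (Finset.mem_sdiff.2 ⟨hb, h'⟩); omega
      · have := hg1 a (Finset.mem_sdiff.2 ⟨ha, h⟩); omega
      · exact hg2 a (Finset.mem_sdiff.2 ⟨ha, h⟩) b (Finset.mem_sdiff.2 ⟨hb, h'⟩) hab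
  · refine ⟨fun x => if x = u then f y else f x, ?_, ?_⟩
    · intro x hx
      by_cases h : x = u
      · simp only [h, if_true]; exact hf1 y hyE
      · simp only [h, if_false]; exact hf1 x (Finset.mem_erase.2 ⟨h, hx⟩)
    · have key : ∀ t ∈ S, t ≠ u → DAdj A t u → f t ≠ f y := by
        intro t ht htu h
        rcases hdom t ht h with e | e
        · subst e; exact absurd (DAdj_symm h) hadj
        · exact hf2 t (Finset.mem_erase.2 ⟨htu, ht⟩) y hyE e
      intro a ha b hb hab
      by_cases h : a = u <;> by_cases h' : b = u <;> simp only [h, h', if_true, if_false]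
      · exact absurd (h.trans h'.symm) (hne hab)
      · subst h; exact (key b hb h' (DAdj_symm hab)).symm
      · subst h'; exact key a ha h hab
      · exact hf2 a (Finset.mem_erase.2 ⟨h, ha⟩) b (Finset.mem_erase.2 ⟨h', hb⟩) hab

open Classical in
theorem col_split {S : Finset V} {n : ℕ} (hcl : CliqueLe A S n)
    (ih : ∀ T : Finset V, T ⊂ S → ∀ m, CliqueLe A T m → Col A T m)
    {Z : Finset V} (hZS : Z ⊂ S) (hZ : Z.Nonempty)
    (hcls : ∀ x ∈ Z, ∀ y ∈ S, DAdj A x y → y ∈ Z) : Col A S n := by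
  obtain ⟨f, hf1, hf2⟩ := ih Z hZS n (hcl.mono hZS.1)
  obtain ⟨g, hg1, hg2⟩ := ih (S \ Z) (by
    refine ⟨Finset.sdiff_subset, fun h => ?_⟩
    obtain ⟨z, hz⟩ := hZ
    exact (Finset.mem_sdiff.1 (h (hZS.1 hz))).2 hz) n (hcl.mono Finset.sdiff_subset)
  refine ⟨fun x => if x ∈ Z then f x else g x, ?_, ?_⟩
  · intro x hx
    by_cases h : x ∈ Z
    · simp only [h, if_true]; exact hf1 x h
    · simp only [h, if_false]; exact hg1 x (Finset.mem_sdiff.2 ⟨hx, h⟩)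
  · intro a ha b hb hab
    by_cases h : a ∈ Z <;> by_cases h' : b ∈ Z <;> simp only [h, h', if_true, if_false]
    · exact hf2 a h b h' hab
    · exact absurd (hcls a h b hb hab) h'
    · exact absurd (hcls b h' a ha (DAdj_symm hab)) h
    · exact hg2 a (Finset.mem_sdiff.2 ⟨ha, h⟩) b (Finset.mem_sdiff.2 ⟨hb, h'⟩) hab

open Classical in
theorem col_base {S : Finset V} (hirr : Irreflexive A) (hD : ArcLocallyOut A)
    (hno : ¬ ∃ k, Odd k ∧ 5 ≤ k ∧ ∃ s : ZMod k → V, Hole A s)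
    (hnd : ∀ u ∈ S, ∀ y ∈ S, u ≠ y → ∃ t ∈ S, DAdj A t u ∧ t ≠ y ∧ ¬ DAdj A t y)
    (hconn : ∀ Z : Finset V, Z ⊆ S → Z.Nonempty → (∀ x ∈ Z, ∀ y ∈ S, DAdj A x y → y ∈ Z) →
      S ⊆ Z) : Col A S 2 := by
  let B : S → S → Prop := fun x y => A x.1 y.1
  have hirr' : Irreflexive B := fun x h => hirr x.1 h
  have hD' : ArcLocallyOut B := by
    intro v1 v2 v3 v4 h1 h2 h3 h4 h5 h6
    have i : ∀ {a b : S}, a ≠ b → a.1 ≠ b.1 := fun h e => h (Subtype.ext e)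
    exact hD v1 v2 v3 v4 (i h1) (i h2) (i h3) (i h4) (i h5) (i h6)
  have hnd' : ND B := by
    intro u y huy
    obtain ⟨t, ht, h1, h2, h3⟩ := hnd u u.2 y y.2 (fun e => huy (Subtype.ext e))
    exact ⟨⟨t, ht⟩, h1, fun e => h2 (congrArg Subtype.val e), h3⟩
  have hconn' : ∀ Z : Set S, Z.Nonempty → (∀ x ∈ Z, ∀ y, DAdj B x y → y ∈ Z) →
      Z = Set.univ := by
    intro Z hZ hcl
    let Z' : Finset V := S.filter (fun x => ∃ h : x ∈ S, (⟨x, h⟩ : S) ∈ Z)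
    have hm : ∀ x, x ∈ Z' ↔ ∃ h : x ∈ S, (⟨x, h⟩ : S) ∈ Z := by
      intro x
      rw [Finset.mem_filter]
      exact ⟨fun h => h.2, fun h => ⟨h.1, h⟩⟩
    have := hconn Z' (Finset.filter_subset _ _) (by
        obtain ⟨z, hz⟩ := hZ
        exact ⟨z.1, (hm _).2 ⟨z.2, hz⟩⟩) (by
        intro x hx y hy hxy
        obtain ⟨h, hx'⟩ := (hm x).1 hx
        exact (hm y).2 ⟨hy, hcl ⟨x, h⟩ hx' ⟨y, hy⟩ hxy⟩)
    ext x
    simp only [Set.mem_univ, iff_true]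
    exact ((hm x.1).1 (this x.2)).2
  have fin2 : (∃ f : S → ℕ, (∀ x, f x < 2) ∧ ∀ u v, DAdj B u v → f u ≠ f v) → Col A S 2 := by
    rintro ⟨f, h1, h2⟩
    refine ⟨fun x => if h : x ∈ S then f ⟨x, h⟩ else 0, ?_, ?_⟩
    · intro x hx
      simp only [hx, dif_pos]; exact h1 _
    · intro u hu v hv huv
      simp only [hu, hv, dif_pos]; exact h2 _ _ huv
  rcases core hirr' hD' hnd' hconn' with ⟨T, hT⟩ | hst
  · apply fin2
    refine ⟨fun x => if x ∈ T then 0 else 1, ?_, ?_⟩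
    · intro x
      by_cases h : x ∈ T <;> simp [h]
    · intro u v huv
      have : u ∈ T ↔ v ∉ T := by
        rcases huv with h | h
        · exact hT u v h
        · have := hT v u h; tauto
      by_cases h : u ∈ T <;> by_cases h' : v ∈ T <;> simp [h, h'] <;> tauto
  · have hadj : ∀ u v, (SimpleGraph.fromRel B).Adj u v ↔ DAdj B u v := by
      intro u v
      rw [SimpleGraph.fromRel_adj]
      refine ⟨fun h => h.2, fun h => ⟨?_, h⟩⟩
      rintro rfl
      rcases h with h | h <;> exact hirr' u h
    by_cases hc : (SimpleGraph.fromRel B).Colorable 2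
    · obtain ⟨c⟩ := hc
      apply fin2
      refine ⟨fun x => (c x).1, fun x => (c x).2, fun u v huv e => ?_⟩
      exact c.valid ((hadj u v).2 huv) (Fin.ext e)
    · exfalso
      obtain ⟨k, hk, h5, s, hs⟩ := odd_hole (SimpleGraph.fromRel B)
        (fun a b c h1 h2 h3 => tri_free hirr' hD' hst hnd' ((hadj _ _).1 h1)
          ((hadj _ _).1 h2) ((hadj _ _).1 h3)) hc
      have hs' : ∀ i j, DAdj A (s i).1 (s j).1 ↔ (j = i + 1 ∨ i = j + 1) := by
        intro i j
        rw [← hs i j, hadj]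
        exact Iff.rfl
      obtain ⟨s', h'⟩ := orient (s := fun i => (s i).1) hD h5 hk hs'
      exact hno ⟨k, hk, h5, s', h'⟩

open Classical in
theorem col_all (hirr : Irreflexive A) (hD : ArcLocallyOut A)
    (hno : ¬ ∃ k, Odd k ∧ 5 ≤ k ∧ ∃ s : ZMod k → V, Hole A s) (S : Finset V) :
    ∀ n, CliqueLe A S n → Col A S n := by
  induction S using Finset.strongInduction with
  | H S ih =>
    intro n hcl
    have hne : ∀ {p q : V}, DAdj A p q → p ≠ q := by
      rintro p q (h | h) e <;> subst e <;> exact hirr p h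
    by_cases hd : ∃ u ∈ S, ∃ y ∈ S, u ≠ y ∧ ∀ t ∈ S, DAdj A t u → t = y ∨ DAdj A t y
    · obtain ⟨u, hu, y, hy, huy, h⟩ := hd
      exact col_dom hirr hcl ih hu hy huy h
    by_cases hz : ∃ Z : Finset V, Z ⊂ S ∧ Z.Nonempty ∧ ∀ x ∈ Z, ∀ y ∈ S, DAdj A x y → y ∈ Z
    · obtain ⟨Z, h1, h2, h3⟩ := hz
      exact col_split hcl ih h1 h2 h3
    by_cases he : ∃ u ∈ S, ∃ v ∈ S, DAdj A u v
    · obtain ⟨u, hu, v, hv, huv⟩ := he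
      have h2 : 2 ≤ n := by
        have := hcl {u, v} (by
          intro x hx
          rcases Finset.mem_insert.1 hx with rfl | hx
          · exact hu
          · rw [Finset.mem_singleton.1 hx]; exact hv) (by
          intro a ha b hb hab
          simp only [Finset.mem_insert, Finset.mem_singleton] at ha hb
          rcases ha with rfl | rfl <;> rcases hb with rfl | rfl
          · exact absurd rfl hab
          · exact huv
          · exact DAdj_symm huv
          · exact absurd rfl hab)
        rwa [Finset.card_pair (hne huv)] at this
      obtain ⟨f, hf1, hf2⟩ := col_base (S := S) hirr hD hno (by
          intro u hu y hy huy
          by_contra hcon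
          refine hd ⟨u, hu, y, hy, huy, fun t ht h => ?_⟩
          by_contra hcc
          exact hcon ⟨t, ht, h, fun e => hcc (Or.inl e), fun e => hcc (Or.inr e)⟩) (by
          intro Z hZS hZ hc
          by_contra hcon
          exact hz ⟨Z, ⟨hZS, hcon⟩, hZ, hc⟩)
      exact ⟨f, fun x hx => (hf1 x hx).trans_le h2, hf2⟩
    · refine ⟨fun _ => 0, fun x hx => ?_, fun u hu v hv huv => absurd ⟨u, hu, v, hv, huv⟩ he⟩
      have := hcl {x} (Finset.singleton_subset_iff.2 hx) (by
        intro a ha b hb hab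
        rw [Finset.mem_singleton] at ha hb
        exact absurd (ha.trans hb.symm) hab)
      rw [Finset.card_singleton] at this
      exact this

open Classical in
theorem diperfect_of_no_hole [Finite V] (hirr : Irreflexive A) (hD : ArcLocallyOut A)
    (hno : ¬ ∃ k, Odd k ∧ 5 ≤ k ∧ ∃ s : ZMod k → V, Hole A s) : Diperfect A := by
  intro S
  haveI := Fintype.ofFinite V
  have hadj : ∀ u v : S, ((Underlying A).induce S).Adj u v ↔ u ≠ v ∧ DAdj A u.1 v.1 := by
    intro u v
    rw [SimpleGraph.comap_adj]
    unfold Underlying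
    rw [SimpleGraph.fromRel_adj]
    exact and_congr_left fun _ => not_congr Subtype.ext_iff.symm
  apply le_antisymm
  · apply SimpleGraph.Colorable.chromaticNumber_le
    obtain ⟨f, hf1, hf2⟩ := col_all hirr hD hno S.toFinset
      ((Underlying A).induce S).cliqueNum (by
      intro K hK hc
      have hcard : (K.subtype (· ∈ S)).card = K.card := by
        rw [Finset.card_subtype, Finset.filter_true_of_mem]
        exact fun x hx => Set.mem_toFinset.1 (hK hx)
      rw [← hcard]
      apply SimpleGraph.IsClique.card_le_cliqueNum
      intro a ha b hb hab
      rw [hadj]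
      refine ⟨hab, hc _ ?_ _ ?_ fun e => hab (Subtype.ext e)⟩
      · exact Finset.mem_subtype.1 (Finset.mem_coe.1 ha)
      · exact Finset.mem_subtype.1 (Finset.mem_coe.1 hb))
    refine ⟨SimpleGraph.Coloring.mk
      (fun x => ⟨f x.1, hf1 x.1 (Set.mem_toFinset.2 x.2)⟩) ?_⟩
    intro u v huv e
    exact hf2 u.1 (Set.mem_toFinset.2 u.2) v.1 (Set.mem_toFinset.2 v.2) ((hadj u v).1 huv).2
      (congrArg Fin.val e)
  · exact SimpleGraph.cliqueNum_le_chromaticNumber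

end Colour

end ALO

/-- A connected arc-locally out-semicomplete digraph is
diperfect, or admits a partition `(V1,V2,V3)` with `D[V1]` semicomplete,
`V2 ↦ V1`, `V3 ⇒ V1` (no arc from `V1` to `V3`), `D[V2]` an odd extended cycle
of length at least five, `V3 ⇒ V2` (no arc from `V2` to `V3`) and `D[V3]`
bipartite (`V1`, `V3` possibly empty), or has a clique cut. -/
theorem stmt_11 {V : Type*} [Fintype V] (A : V → V → Prop) (hirr : Irreflexive A)
    (hD : ArcLocallyOut A) (hconn : IsConnected' A) :
    Diperfect A ∨
      (∃ V1 V2 V3 : Set V, Disjoint V1 V2 ∧ Disjoint V1 V3 ∧ Disjoint V2 V3 ∧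
        V1 ∪ V2 ∪ V3 = Set.univ ∧
        SemicompleteOn A V1 ∧
        (∀ v ∈ V2, ∀ u ∈ V1, A v u) ∧
        (∀ u ∈ V1, ∀ v ∈ V2, ¬ A u v) ∧
        (∀ u ∈ V1, ∀ w ∈ V3, ¬ A u w) ∧
        IsOddExtCycle5On A V2 ∧
        (∀ v ∈ V2, ∀ w ∈ V3, ¬ A v w) ∧
        BipartiteOn A V3) ∨
      HasCliqueCut A := by
  by_cases hh : ∃ k, Odd k ∧ 5 ≤ k ∧ ∃ s : ZMod k → V, ALO.Hole A s
  · obtain ⟨k, hk, h5, s, hs⟩ := hh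
    exact Or.inr (ALO.struct hirr hD h5 hk hs)
  · exact Or.inl (ALO.diperfect_of_no_hole hirr hD hh)
end

section
/- Let D be a connected arc-locally semicomplete digraph. Then D is either a diperfect digraph or an odd extended cycle of length at least five. -/
variable {V : Type*}

/-- Symmetric form of the in-condition. -/
theorem in_sym {V : Type*} {A : V → V → Prop} (hirr : Irreflexive A) (hin : ArcLocallyIn A)
    {a b c d : V} (hac : a ≠ c) (had : a ≠ d) (hbd : b ≠ d)
    (h1 : A a b) (h2 : DAdj A b c) (h3 : A d c) : DAdj A a d := by
  have hab : a ≠ b := by rintro rfl; exact hirr _ h1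
  have hdc : d ≠ c := by rintro rfl; exact hirr _ h3
  have hbc : b ≠ c := by rintro rfl; rcases h2 with h | h <;> exact hirr _ h
  rcases h2 with h | h
  · exact hin a b c d hab hac had hbc hbd hdc.symm h1 h h3
  · exact (hin d c b a hdc hbd.symm had.symm hbc.symm hac.symm hab.symm h3 h h1).symm

/-- Symmetric form of the out-condition. -/
theorem out_sym {V : Type*} {A : V → V → Prop} (hirr : Irreflexive A) (hout : ArcLocallyOut A)
    {a b c d : V} (hac : a ≠ c) (had : a ≠ d) (hbd : b ≠ d)
    (h1 : A b a) (h2 : DAdj A b c) (h3 : A c d) : DAdj A a d := by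
  have hab : a ≠ b := by rintro rfl; exact hirr _ h1
  have hdc : d ≠ c := by rintro rfl; exact hirr _ h3
  have hbc : b ≠ c := by rintro rfl; rcases h2 with h | h <;> exact hirr _ h
  rcases h2 with h | h
  · exact hout a b c d hab hac had hbc hbd hdc.symm h1 h h3
  · exact (hout d c b a hdc hbd.symm had.symm hbc.symm hac.symm hab.symm h3 h h1).symm

/-- No induced paw. -/
theorem no_paw {V : Type*} {A : V → V → Prop} (hirr : Irreflexive A)
    (hin : ArcLocallyIn A) (hout : ArcLocallyOut A) {w a b c : V}
    (h1 : DAdj A w a) (h2 : DAdj A a b) (h3 : DAdj A a c) (h4 : DAdj A b c)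
    (hb : w ≠ b) (hc : w ≠ c) : DAdj A w b ∨ DAdj A w c := by
  have hac : a ≠ c := by rintro rfl; rcases h3 with h | h <;> exact hirr _ h
  have hab : a ≠ b := by rintro rfl; rcases h2 with h | h <;> exact hirr _ h
  rcases h1 with h1 | h1 <;> rcases h4 with h4 | h4
  · exact Or.inl (in_sym hirr hin hc hb hab h1 h3 h4)
  · exact Or.inr (in_sym hirr hin hb hc hac h1 h2 h4)
  · exact Or.inr (out_sym hirr hout hb hc hac h1 h2 h4)
  · exact Or.inl (out_sym hirr hout hc hb hab h1 h3 h4)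

/-- A connected paw-free graph with a triangle can be coloured with `ω` colours. -/
theorem colorable_of_paw_free {W : Type*} [Finite W] (H : SimpleGraph W) (hc : H.Connected)
    (hP : ∀ w a b c, H.Adj w a → H.Adj a b → H.Adj a c → H.Adj b c → w ≠ b → w ≠ c →
      H.Adj w b ∨ H.Adj w c) (h3 : 3 ≤ H.cliqueNum) : H.Colorable H.cliqueNum := by
  classical
  obtain ⟨s, hs, hcard⟩ := H.exists_isNClique_cliqueNum
  have hne : s.Nonempty := by
    rw [← Finset.card_pos]; omega
  obtain ⟨z, hz⟩ := hne
  have key : ∀ v, ∃ b ∈ s, ∀ c ∈ s, c ≠ b → H.Adj v c := by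
    have step : ∀ v w, H.Adj v w → (∃ b ∈ s, ∀ c ∈ s, c ≠ b → H.Adj v c) →
        (∃ b ∈ s, ∀ c ∈ s, c ≠ b → H.Adj w c) := by
      rintro v w hvw ⟨b, hb, hbs⟩
      by_cases hw : w ∈ s
      · exact ⟨w, hw, fun c hcs hne => hs hw hcs hne.symm⟩
      by_cases hA : ∃ a ∈ s, H.Adj w a
      · obtain ⟨a, ha, hwa⟩ := hA
        by_cases hall : ∀ c ∈ s, H.Adj w c
        · exact ⟨a, ha, fun c hcs _ => hall c hcs⟩
        push Not at hall
        obtain ⟨e, he, hwe⟩ := hall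
        refine ⟨e, he, fun c hcs hce => ?_⟩
        by_contra hwc
        have hae : a ≠ e := by rintro rfl; exact hwe hwa
        have hac : a ≠ c := by rintro rfl; exact hwc hwa
        rcases hP w a e c hwa (hs ha he hae) (hs ha hcs hac) (hs he hcs hce.symm)
          (by rintro rfl; exact hw he) (by rintro rfl; exact hw hcs) with h | h
        · exact hwe h
        · exact hwc h
      · exfalso
        have : 1 < (s.erase b).card := by rw [Finset.card_erase_of_mem hb]; omega
        obtain ⟨p, hp, q, hq, hpq⟩ := Finset.one_lt_card.1 this
        rw [Finset.mem_erase] at hp hq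
        rcases hP w v p q hvw.symm (hbs p hp.2 hp.1) (hbs q hq.2 hq.1) (hs hp.2 hq.2 hpq)
          (by rintro rfl; exact hw hp.2) (by rintro rfl; exact hw hq.2) with h | h
        · exact hA ⟨p, hp.2, h⟩
        · exact hA ⟨q, hq.2, h⟩
    have walk : ∀ u v, H.Walk u v → (∃ b ∈ s, ∀ c ∈ s, c ≠ b → H.Adj u c) →
        (∃ b ∈ s, ∀ c ∈ s, c ≠ b → H.Adj v c) := by
      intro u v p
      induction p with
      | nil => exact id
      | cons h _ ih => exact fun hu => ih (step _ _ h hu)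
    intro v
    obtain ⟨p⟩ := hc.preconnected z v
    exact walk _ _ p ⟨z, hz, fun c hcs hne => hs hz hcs hne.symm⟩
  choose f hf1 hf2 using key
  have C : H.Coloring s := SimpleGraph.Coloring.mk (fun v => ⟨f v, hf1 v⟩) (by
    intro v w hvw heq
    have heq : f v = f w := by simpa using heq
    have hclique : H.IsClique (insert v (insert w (s.erase (f v))) : Finset W) := by
      rw [Finset.coe_insert, Finset.coe_insert]
      refine SimpleGraph.IsClique.insert (SimpleGraph.IsClique.insert ?_ ?_) ?_
      · exact hs.subset (by simp)
      · intro b hb _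
        simp only [Finset.coe_erase, Set.mem_sdiff, Finset.mem_coe, Set.mem_singleton_iff] at hb
        exact hf2 w b hb.1 (heq ▸ hb.2)
      · intro b hb _
        simp only [Finset.coe_erase, Set.mem_insert_iff, Set.mem_sdiff, Finset.mem_coe,
          Set.mem_singleton_iff] at hb
        rcases hb with rfl | hb
        · exact hvw
        · exact hf2 v b hb.1 hb.2
    have hle := hclique.card_le_cliqueNum
    have hw' : w ∉ s.erase (f v) := by
      intro h
      rw [Finset.mem_erase] at h
      exact H.loopless.irrefl _ (hf2 w w h.2 (heq ▸ h.1))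
    have hv' : v ∉ insert w (s.erase (f v)) := by
      intro h
      rw [Finset.mem_insert, Finset.mem_erase] at h
      rcases h with h | h
      · exact hvw.ne h
      · exact H.loopless.irrefl _ (hf2 v v h.2 h.1)
    rw [Finset.card_insert_of_notMem hv', Finset.card_insert_of_notMem hw',
      Finset.card_erase_of_mem (hf1 v)] at hle
    omega)
  have := C.colorable
  rwa [Fintype.card_coe, hcard] at this

/-- A triangle-free non-bipartite graph contains an odd hole. -/
theorem exists_odd_hole {W : Type*} (H : SimpleGraph W) (h3 : H.CliqueFree 3)
    (h2 : ¬ H.Colorable 2) : ∃ k : ℕ, Odd k ∧ 5 ≤ k ∧ ∃ x : ZMod k → W,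
      ∀ i j, H.Adj (x i) (x j) ↔ (j = i + 1 ∨ i = j + 1) := by
  classical
  rw [SimpleGraph.two_colorable_iff_forall_loop_even] at h2
  push Not at h2
  have hex : ∃ k, Odd k ∧ ∃ u, ∃ w : H.Walk u u, w.length = k := by
    obtain ⟨u, w, hw⟩ := h2
    exact ⟨_, by simpa using hw, u, w, rfl⟩
  obtain ⟨hodd, u, w, hwk⟩ := Nat.find_spec hex
  have hmin : ∀ m, Odd m → ∀ u, ∀ w : H.Walk u u, w.length = m → Nat.find hex ≤ m :=
    fun m hm u w hw => Nat.find_min' hex ⟨hm, u, w, hw⟩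
  generalize Nat.find hex = k at hodd hwk hmin
  have hk0 : 0 < k := hodd.pos
  have : NeZero k := ⟨hk0.ne'⟩
  obtain ⟨x, hx⟩ : ∃ x : ZMod k → W, ∀ i, H.Adj (x i) (x (i + 1)) := by
    refine ⟨fun i => w.getVert i.val, fun i => ?_⟩
    change H.Adj (w.getVert i.val) (w.getVert (i + 1).val)
    have hi := ZMod.val_lt i
    have hadj := w.adj_getVert_succ (i := i.val) (by omega)
    have hk1 : k ≠ 1 := by
      rintro rfl
      have h0 : i.val = 0 := by omega
      rw [h0, ← hwk] at hadj
      have := w.getVert_length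
      rw [hwk] at this
      rw [w.getVert_zero, zero_add, hwk, this] at hadj
      exact H.loopless.irrefl _ hadj
    have : Fact (1 < k) := ⟨by omega⟩
    by_cases hlt : i.val + 1 < k
    · rw [ZMod.val_add_of_lt (by rw [ZMod.val_one k]; exact hlt), ZMod.val_one k]
      exact hadj
    · have h1 : i.val + 1 = k := by omega
      have h0 : (i + 1) = 0 := by
        rw [← ZMod.natCast_zmod_val i]
        have : ((i.val + 1 : ℕ) : ZMod k) = 0 := by rw [h1]; simp
        simpa using this
      rw [h0, ZMod.val_zero, w.getVert_zero]
      have h2 := w.getVert_length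
      rw [hwk] at h2
      rwa [h1, h2] at hadj
  have hwalk : ∀ (n : ℕ) (i : ZMod k), ∃ p : H.Walk (x i) (x (i + n)), p.length = n := by
    intro n
    induction n with
    | zero => intro i; rw [Nat.cast_zero, add_zero]; exact ⟨.nil, rfl⟩
    | succ n ih =>
      intro i
      obtain ⟨p, hp⟩ := ih i
      have h := hx (i + n)
      have e : i + ((n + 1 : ℕ) : ZMod k) = i + n + 1 := by push_cast; ring
      rw [e]
      exact ⟨p.concat h, by simp [hp]⟩
  have hchord : ∀ i j, H.Adj (x i) (x j) → (j = i + 1 ∨ i = j + 1) := by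
    intro i j hij
    have hd := ZMod.val_lt (j - i)
    obtain ⟨d, hdd⟩ : ∃ d, d = (j - i).val := ⟨_, rfl⟩
    have hcast : (d : ZMod k) = j - i := by rw [hdd]; simp
    have hj : j = i + (d : ZMod k) := by rw [hcast]; ring
    have hi : i = j + ((k - d : ℕ) : ZMod k) := by
      rw [Nat.cast_sub (by omega), hcast]; simp
    by_contra hcon
    push Not at hcon
    have hd0 : d ≠ 0 := by
      rintro rfl
      have : j = i := by simpa using hj
      rw [this] at hij
      exact H.loopless.irrefl _ hij
    have hd1 : d ≠ 1 := by
      rintro rfl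
      exact hcon.1 (by simpa using hj)
    have hdk : k - d ≠ 1 := by
      intro h
      rw [h] at hi
      exact hcon.2 (by simpa using hi)
    have w1 : ∃ p : H.Walk (x i) (x j), p.length = d := by rw [hj]; exact hwalk d i
    have w2 : ∃ p : H.Walk (x j) (x i), p.length = k - d := by
      have := hwalk (k - d) j
      rwa [← hi] at this
    obtain ⟨p, hp⟩ := w1
    obtain ⟨q, hq⟩ := w2
    have m1 : Odd (d + 1) → k ≤ d + 1 := fun h =>
      hmin _ h _ (p.concat hij.symm) (by simp [hp])
    have m2 : Odd (k - d + 1) → k ≤ k - d + 1 := fun h =>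
      hmin _ h _ (q.concat hij) (by simp [hq])
    rcases Nat.even_or_odd d with he | ho
    · have := m1 he.add_one
      omega
    · have := m2 (by
        have : Even (k - d) := Nat.Odd.sub_odd hodd ho
        exact this.add_one)
      omega
  have hk1 : k ≠ 1 := by
    rintro rfl
    have h := hx 0
    rw [Subsingleton.elim (0 + 1 : ZMod 1) 0] at h
    exact H.loopless.irrefl _ h
  have hk3 : k ≠ 3 := by
    rintro rfl
    apply h3 {x 0, x 1, x 2}
    rw [SimpleGraph.is3Clique_triple_iff]
    have a := hx 0
    have b := hx 1
    have c := hx 2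
    have e1 : (0 + 1 : ZMod 3) = 1 := by decide
    have e2 : (1 + 1 : ZMod 3) = 2 := by decide
    have e3 : (2 + 1 : ZMod 3) = 0 := by decide
    rw [e1] at a
    rw [e2] at b
    rw [e3] at c
    exact ⟨a, c.symm, b⟩
  refine ⟨k, hodd, ?_, x, fun i j => ⟨hchord i j, ?_⟩⟩
  · obtain ⟨m, hm⟩ := hodd
    omega
  · rintro (rfl | rfl)
    · exact hx i
    · exact (hx j).symm

/-- small numerals do not vanish modulo an odd number at least five -/
theorem zmod_small {k : ℕ} (hodd : Odd k) (hk : 5 ≤ k) :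
    (1 : ZMod k) ≠ 0 ∧ (2 : ZMod k) ≠ 0 ∧ (3 : ZMod k) ≠ 0 ∧ (4 : ZMod k) ≠ 0 ∧
      (6 : ZMod k) ≠ 0 := by
  have gen : ∀ n : ℕ, 0 < n → n < 7 → n ≠ 5 → ((n : ℕ) : ZMod k) ≠ 0 := by
    intro n h0 h7 h5 h
    rw [ZMod.natCast_eq_zero_iff] at h
    have hle := Nat.le_of_dvd h0 h
    obtain ⟨m, hm⟩ := hodd
    have h6 : n = 6 := by omega
    have hk5 : k = 5 := by omega
    subst h6 hk5
    omega
  refine ⟨?_, ?_, ?_, ?_, ?_⟩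
  · simpa using gen 1 (by norm_num) (by norm_num) (by norm_num)
  · simpa using gen 2 (by norm_num) (by norm_num) (by norm_num)
  · simpa using gen 3 (by norm_num) (by norm_num) (by norm_num)
  · simpa using gen 4 (by norm_num) (by norm_num) (by norm_num)
  · simpa using gen 6 (by norm_num) (by norm_num) (by norm_num)

/-- induced directed cycle -/
def IsC {V : Type*} (A : V → V → Prop) {k : ℕ} (x : ZMod k → V) : Prop :=
  ∀ i j, A (x i) (x j) ↔ j = i + 1

/-- `v` is a twin of `x m` -/
def Twin {V : Type*} (A : V → V → Prop) {k : ℕ} (x : ZMod k → V) (m : ZMod k) (v : V) : Prop :=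
  ∀ j, (A (x j) v ↔ j = m - 1) ∧ (A v (x j) ↔ j = m + 1)

theorem IsC.inj {V : Type*} {A : V → V → Prop} {k : ℕ} {x : ZMod k → V} (h : IsC A x)
    {i j : ZMod k} (hij : x i = x j) : i = j := by
  have h1 := (h i (i + 1)).2 rfl
  rw [hij] at h1
  exact add_right_cancel ((h j (i + 1)).1 h1)

theorem IsC.dadj {V : Type*} {A : V → V → Prop} {k : ℕ} {x : ZMod k → V} (h : IsC A x)
    {i j : ZMod k} : DAdj A (x i) (x j) ↔ (j = i + 1 ∨ i = j + 1) := by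
  unfold DAdj
  rw [h i j, h j i]

/-- An odd hole is a directed cycle. -/
theorem isC_of_hole {V : Type*} {A : V → V → Prop} (hirr : Irreflexive A)
    (hin : ArcLocallyIn A) (hout : ArcLocallyOut A) {k : ℕ} (hodd : Odd k) (hk : 5 ≤ k)
    (x : ZMod k → V) (hx : ∀ i j, DAdj A (x i) (x j) ↔ (j = i + 1 ∨ i = j + 1)) :
    ∃ y : ZMod k → V, IsC A y := by
  obtain ⟨n1, n2, n3, n4, n6⟩ := zmod_small hodd hk
  have hinj : ∀ i j, x i = x j → i = j := by
    intro i j hij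
    have h1 := (hx i (i + 1)).2 (Or.inl rfl)
    have h2 := (hx i (i - 1)).2 (Or.inr (by ring))
    rw [hij, hx] at h1 h2
    grind
  -- we may assume that the first arc is forward
  wlog h01 : A (x 0) (x 1) generalizing x with Hw
  · refine Hw (fun i => x (1 - i)) ?_ ?_ ?_
    · intro i j
      simp only [hx]
      grind
    · intro i j hij
      have := hinj _ _ hij
      grind
    · have := (hx 0 1).2 (Or.inl (by ring))
      simp only [sub_zero, sub_self]
      exact this.resolve_left h01
  have step : ∀ i, A (x i) (x (i + 1)) → ¬ A (x (i + 3)) (x (i + 2)) := by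
    intro i h1 h2
    have := in_sym hirr hin (a := x i) (b := x (i + 1)) (c := x (i + 2)) (d := x (i + 3))
      (fun h => n2 (by linear_combination -(hinj _ _ h))) (fun h => n3 (by linear_combination -(hinj _ _ h)))
      (fun h => n2 (by linear_combination -(hinj _ _ h))) h1 ((hx _ _).2 (by grind)) h2
    rw [hx] at this
    rcases this with h | h
    · exact n2 (by linear_combination h)
    · exact n4 (by linear_combination -h)
  have step2 : ∀ i, A (x i) (x (i + 1)) → A (x (i + 2)) (x (i + 2 + 1)) := by
    intro i h
    have e : i + 2 + 1 = i + 3 := by ring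
    rw [e]
    exact ((hx (i + 2) (i + 3)).2 (by grind)).resolve_right (step i h)
  have hall2 : ∀ n : ℕ, A (x (2 * n)) (x (2 * n + 1)) := by
    intro n
    induction n with
    | zero => simpa using h01
    | succ n ih =>
      have := step2 _ ih
      have e : (2 : ZMod k) * ((n + 1 : ℕ) : ZMod k) = 2 * n + 2 := by push_cast; ring
      rw [e]
      exact this
  have hall : ∀ i, A (x i) (x (i + 1)) := by
    intro i
    obtain ⟨m, hm⟩ := hodd
    have : NeZero k := ⟨by omega⟩
    have hm' : (2 : ZMod k) * m + 1 = 0 := by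
      have : ((2 * m + 1 : ℕ) : ZMod k) = 0 := by rw [← hm]; simp
      simpa using this
    have := hall2 (i.val * (m + 1))
    have e : (2 : ZMod k) * ((i.val * (m + 1) : ℕ) : ZMod k) = i := by
      push_cast
      rw [ZMod.natCast_zmod_val]
      linear_combination i * hm'
    rwa [e] at this
  refine ⟨x, fun i j => ⟨fun h => ?_, ?_⟩⟩
  · rcases (hx i j).1 (Or.inl h) with e | e
    · exact e
    · exfalso
      have := step (j - 2) (hall _)
      have e1 : j - 2 + 3 = i := by rw [e]; ring
      have e2 : j - 2 + 2 = j := by ring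
      rw [e1, e2] at this
      exact this h
  · rintro rfl
    exact hall i

/-- A vertex with a neighbour on the cycle is a twin of a cycle vertex. -/
theorem twin_of_adj {V : Type*} {A : V → V → Prop} (hirr : Irreflexive A)
    (hin : ArcLocallyIn A) (hout : ArcLocallyOut A) {k : ℕ} (hodd : Odd k) (hk : 5 ≤ k)
    {x : ZMod k → V} (hx : IsC A x) {v : V} {i : ZMod k} (hv : DAdj A v (x i)) :
    ∃ m, Twin A x m v := by
  obtain ⟨n1, n2, n3, n4, n6⟩ := zmod_small hodd hk
  by_cases hvC : ∃ m, v = x m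
  · obtain ⟨m, rfl⟩ := hvC
    refine ⟨m, fun j => ⟨?_, hx m j⟩⟩
    rw [hx]
    grind
  push Not at hvC
  have ne : ∀ {i j}, i ≠ j → x i ≠ x j := fun h e => h (hx.inj e)
  -- no two consecutive neighbours
  have c1 : ∀ i, DAdj A v (x i) → DAdj A v (x (i + 1)) → ¬ A (x (i + 1)) v := by
    intro i h1 h2 h
    have := in_sym hirr hin (a := x (i - 1)) (b := x i) (c := v) (d := x (i + 1))
      (hvC _).symm (ne (fun h => n2 (by linear_combination -h))) (ne (fun h => n1 (by linear_combination -h))) ((hx _ _).2 (by ring)) h1.symm h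
    rw [hx.dadj] at this
    rcases this with h | h
    · exact n1 (by linear_combination h)
    · exact n3 (by linear_combination -h)
  have c2 : ∀ i, DAdj A v (x i) → DAdj A v (x (i + 1)) → ¬ A v (x i) := by
    intro i h1 h2 h
    have := out_sym hirr hout (a := x i) (b := v) (c := x (i + 1)) (d := x (i + 2))
      (ne (fun h => n1 (by linear_combination -h))) (ne (fun h => n2 (by linear_combination -h))) (hvC _) h h2 ((hx _ _).2 (by ring))
    rw [hx.dadj] at this
    rcases this with h | h
    · exact n1 (by linear_combination h)
    · exact n3 (by linear_combination -h)
  have d1 : ∀ i, A (x i) v → DAdj A v (x (i + 2)) := by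
    intro i h
    exact out_sym hirr hout (a := v) (b := x i) (c := x (i + 1)) (d := x (i + 2))
      (hvC _) (hvC _) (ne (fun h => n2 (by linear_combination -h))) h (hx.dadj.2 (by grind)) ((hx _ _).2 (by ring))
  have d2 : ∀ i, A v (x i) → DAdj A v (x (i - 2)) := by
    intro i h
    exact in_sym hirr hin (a := v) (b := x i) (c := x (i - 1)) (d := x (i - 2))
      (hvC _) (hvC _) (ne (fun h => n2 (by linear_combination h))) h (hx.dadj.2 (by grind)) ((hx _ _).2 (by ring))
  have nocons : ∀ i, DAdj A v (x i) → ¬ DAdj A v (x (i + 1)) := by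
    intro i h1 h2
    have hiv : A (x i) v := h1.resolve_left (c2 i h1 h2)
    have hvi : A v (x (i + 1)) := h2.resolve_right (c1 i h1 h2)
    have h3 := d1 i hiv
    have e : i + 2 = i + 1 + 1 := by ring
    rw [e] at h3
    exact c2 _ h2 h3 hvi
  have nocons' : ∀ i j, DAdj A v (x i) → DAdj A v (x j) → j ≠ i + 1 ∧ i ≠ j + 1 := by
    intro i j h1 h2
    refine ⟨?_, ?_⟩
    · rintro rfl; exact nocons _ h1 h2
    · rintro rfl; exact nocons _ h2 h1
  have e1 : ∀ i j, DAdj A v (x i) → A (x j) v → i ≠ j → j = i - 2 := by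
    intro i j h1 h2 hij
    have hn := nocons' i j h1 (Or.inr h2)
    have := in_sym hirr hin (a := x (i - 1)) (b := x i) (c := v) (d := x j)
      (hvC _).symm (ne (by grind)) (ne hij) ((hx _ _).2 (by ring)) h1.symm h2
    rw [hx.dadj] at this
    grind
  have e2 : ∀ i j, DAdj A v (x i) → A v (x j) → i ≠ j → j = i + 2 := by
    intro i j h1 h2 hij
    have hn := nocons' i j h1 (Or.inl h2)
    have := out_sym hirr hout (a := x (i + 1)) (b := x i) (c := v) (d := x j)
      (hvC _).symm (ne (by grind)) (ne hij) ((hx _ _).2 (by ring)) h1.symm h2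
    rw [hx.dadj] at this
    grind
  have main : ∀ i, DAdj A v (x i) → DAdj A v (x (i + 2)) → Twin A x (i + 1) v := by
    intro i h1 h2
    have hne : i ≠ i + 2 := fun h => n2 (by linear_combination -h)
    have a1 : ¬ A v (x i) := fun h => by have := e2 _ _ h2 h hne.symm; exact n4 (by linear_combination -this)
    have a2 : ¬ A (x (i + 2)) v := fun h => by have := e1 _ _ h1 h hne; exact n4 (by linear_combination this)
    have b1 : A (x i) v := h1.resolve_left a1
    have b2 : A v (x (i + 2)) := h2.resolve_right a2
    intro j
    refine ⟨⟨fun h => ?_, fun h => ?_⟩, ⟨fun h => ?_, fun h => ?_⟩⟩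
    · by_contra hj
      have hj1 : i ≠ j := by grind
      have hj2 : i + 2 ≠ j := by rintro rfl; exact a2 h
      have := e1 _ _ h2 h hj2
      grind
    · have : j = i := by rw [h]; ring
      rwa [this]
    · by_contra hj
      have hj1 : i ≠ j := by rintro rfl; exact a1 h
      have := e2 _ _ h1 h hj1
      grind
    · have : j = i + 2 := by rw [h]; ring
      rwa [this]
  rcases hv with h | h
  · refine ⟨_, main (i - 2) (d2 i h) ?_⟩
    have : i - 2 + 2 = i := by ring
    rw [this]
    exact Or.inl h
  · exact ⟨_, main i (Or.inr h) (d1 i h)⟩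

theorem isC_update {V : Type*} {A : V → V → Prop} (hirr : Irreflexive A) {k : ℕ}
    (hodd : Odd k) (hk : 5 ≤ k) {x : ZMod k → V} (hx : IsC A x) {v : V} {m : ZMod k}
    (hv : Twin A x m v) : IsC A (Function.update x m v) := by
  obtain ⟨n1, n2, n3, n4, n6⟩ := zmod_small hodd hk
  intro i j
  by_cases hi : i = m <;> by_cases hj : j = m
  · subst hi hj
    simp only [Function.update_self]
    exact ⟨fun h => absurd h (hirr _), fun h => absurd h fun h => n1 (by linear_combination -h)⟩
  · subst hi
    rw [Function.update_self, Function.update_of_ne hj]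
    exact (hv j).2
  · subst hj
    rw [Function.update_self, Function.update_of_ne hi, (hv i).1]
    grind
  · rw [Function.update_of_ne hj, Function.update_of_ne hi]
    exact hx i j

/-- A connected digraph with an induced odd directed cycle is an odd extended cycle. -/
theorem extended_of_isC {V : Type*} {A : V → V → Prop} (hirr : Irreflexive A)
    (hin : ArcLocallyIn A) (hout : ArcLocallyOut A) (hconn : IsConnected' A)
    {k : ℕ} (hodd : Odd k) (hk : 5 ≤ k)
    {x : ZMod k → V} (hx : IsC A x) : IsOddExtCycle5On A Set.univ := by
  obtain ⟨n1, n2, n3, n4, n6⟩ := zmod_small hodd hk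
  have self : ∀ m, Twin A x m (x m) := by
    intro m j
    refine ⟨?_, hx m j⟩
    rw [hx]
    grind
  have uniq : ∀ {m m' v}, Twin A x m v → Twin A x m' v → m = m' := by
    intro m m' v h h'
    have := (h' _).2.1 ((h (m + 1)).2.2 rfl)
    exact add_right_cancel this
  have all : ∀ v, ∃ m, Twin A x m v := by
    intro v
    have hr := hconn (x 0) trivial v trivial
    induction hr with
    | refl => exact ⟨0, self 0⟩
    | @tail v w _ hvw ih =>
      obtain ⟨m, hm⟩ := ih
      have hx' := isC_update hirr hodd hk hx hm
      have hw : DAdj A w (Function.update x m v m) := by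
        rw [Function.update_self]
        exact hvw.2.2.symm
      obtain ⟨m', hm'⟩ := twin_of_adj hirr hin hout hodd hk hx' hw
      by_cases hmm : m' + 1 = m
      · have h1 := ((hm' (m' - 1)).1).2 rfl
        rw [Function.update_of_ne (by grind)] at h1
        exact twin_of_adj hirr hin hout hodd hk hx (Or.inr h1)
      · have h1 := ((hm' (m' + 1)).2).2 rfl
        rw [Function.update_of_ne hmm] at h1
        exact twin_of_adj hirr hin hout hodd hk hx (Or.inl h1)
  have arc : ∀ {i u v}, Twin A x i u → (A u v ↔ Twin A x (i + 1) v) := by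
    intro i u v hu
    have hx' := isC_update hirr hodd hk hx hu
    constructor
    · intro huv
      obtain ⟨m, hm⟩ := twin_of_adj hirr hin hout hodd hk hx'
        (v := v) (i := i) (by rw [Function.update_self]; exact Or.inr huv)
      have h1 : i = m - 1 := ((hm i).1).1 (by rw [Function.update_self]; exact huv)
      obtain ⟨j, hj⟩ := all v
      have h2 := ((hm (m + 1)).2).2 rfl
      rw [Function.update_of_ne (fun h => n2 (by linear_combination h + h1))] at h2
      have h3 := ((hj _).2).1 h2
      have : j = i + 1 := by grind
      rwa [this] at hj
    · intro hv
      have h2 := ((hv (i + 1 + 1)).2).2 rfl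
      have h2' : A v (Function.update x i u (i + 1 + 1)) := by
        rwa [Function.update_of_ne (fun h => n2 (by linear_combination h))]
      obtain ⟨m, hm⟩ := twin_of_adj hirr hin hout hodd hk hx' (Or.inl h2')
      have h3 := ((hm _).2).1 h2'
      have h4 := ((hm i).1).2 (by grind)
      rwa [Function.update_self] at h4
  refine ⟨k, hodd, hk, by omega, fun m => {v | Twin A x m v}, fun i => ⟨x i, self i⟩, ?_, ?_, ?_⟩
  · intro i j hij
    rw [Set.disjoint_left]
    intro v h1 h2
    exact hij (uniq h1 h2)
  · ext v
    simpa using all v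
  · intro u _ v _
    constructor
    · intro h
      obtain ⟨i, hi⟩ := all u
      exact ⟨i, hi, (arc hi).1 h⟩
    · rintro ⟨i, hi, hv⟩
      exact (arc hi).2 hv

theorem underlying_adj {V : Type*} {A : V → V → Prop} (hirr : Irreflexive A) (u v : V) :
    (Underlying A).Adj u v ↔ DAdj A u v := by
  unfold Underlying DAdj
  rw [SimpleGraph.fromRel_adj]
  constructor
  · exact fun h => h.2
  · intro h
    refine ⟨?_, h⟩
    rintro rfl
    rcases h with h | h <;> exact hirr _ h

/-- A connected arc-locally semicomplete digraph is either
diperfect or an odd extended cycle of length at least five. -/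
theorem stmt_13 {V : Type*} [Fintype V] (A : V → V → Prop) (hirr : Irreflexive A)
    (hin : ArcLocallyIn A) (hout : ArcLocallyOut A) (hconn : IsConnected' A) :
    Diperfect A ∨ IsOddExtCycle5On A Set.univ := by
  classical
  by_contra hcon
  push Not at hcon
  obtain ⟨hnp, hnc⟩ := hcon
  apply hnp
  intro S
  refine le_antisymm ?_ SimpleGraph.cliqueNum_le_chromaticNumber
  rw [SimpleGraph.chromaticNumber_le_iff_colorable]
  generalize hH : (Underlying A).induce S = H
  have hadj : ∀ a b : S, H.Adj a b ↔ DAdj A a b := by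
    intro a b
    rw [← hH, SimpleGraph.comap_adj]
    exact underlying_adj hirr _ _
  rw [SimpleGraph.colorable_iff_forall_connectedComponent]
  intro c
  have hcadj : ∀ a b : c, c.toSimpleGraph.Adj a b ↔ DAdj A (a : S) (b : S) := by
    intro a b
    rw [← hadj]
    rfl
  have hle : c.toSimpleGraph.cliqueNum ≤ H.cliqueNum := H.cliqueNum_induce_le c.supp
  by_cases h3 : 3 ≤ c.toSimpleGraph.cliqueNum
  · refine (colorable_of_paw_free _ c.connected_toSimpleGraph ?_ h3).mono hle
    intro w a b d
    simp only [hcadj]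
    intro h1 h2 h4 h5 hb hd
    exact no_paw hirr hin hout h1 h2 h4 h5 (fun h => hb (Subtype.ext (Subtype.ext h)))
      (fun h => hd (Subtype.ext (Subtype.ext h)))
  · have hfree : c.toSimpleGraph.CliqueFree 3 := by
      intro t ht
      have := ht.isClique.card_le_cliqueNum
      rw [ht.card_eq] at this
      exact h3 this
    have h2 : c.toSimpleGraph.Colorable 2 := by
      by_contra h2
      obtain ⟨k, hodd, hk, x, hx⟩ := exists_odd_hole _ hfree h2
      obtain ⟨y, hy⟩ := isC_of_hole hirr hin hout hodd hk (fun i => ((x i : S) : V))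
        (fun i j => by rw [← hcadj, hx])
      exact hnc (extended_of_isC hirr hin hout hconn hodd hk hy)
    by_cases hE : ∃ a b : c, c.toSimpleGraph.Adj a b
    · obtain ⟨a, b, hab⟩ := hE
      have hcl : c.toSimpleGraph.IsClique (({a, b} : Finset c) : Set c) := by
        simp [SimpleGraph.isClique_insert, hab]
      have := hcl.card_le_cliqueNum
      rw [Finset.card_pair hab.ne] at this
      exact h2.mono (this.trans hle)
    · push Not at hE
      obtain ⟨v⟩ := c.connected_toSimpleGraph.nonempty
      have hcl : c.toSimpleGraph.IsClique (({v} : Finset c) : Set c) := by simp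
      have := hcl.card_le_cliqueNum
      rw [Finset.card_singleton] at this
      have h1 : c.toSimpleGraph.Colorable 1 :=
        ⟨SimpleGraph.Coloring.mk (fun _ => 0) (fun {a b} h => absurd h (hE a b))⟩
      exact h1.mono (this.trans hle)
end
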